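/- Let f be an endomorphism of A₁ with P = f(X) and Q = f(Y). If there exists an involution Γ on A₁, conjugate to α, such that Γ(P) = Q and Γ(Q) = P, then f is an automorphism of A₁. -/

import Mathlib

noncomputable section

/-- `f : A → A` is a `K`-algebra endomorphism (as a bare function). -/
def IsAlgEndo (K : Type) [CommSemiring K] {A : Type} [Semiring A] [Algebra K A]
    (f : A → A) : Prop :=
  (∀ a b : A, f (a + b) = f a + f b) ∧
  (∀ (c : K) (a : A), f (c • a) = c • f a) ∧
  (∀ a b : A, f (a * b) = f a * f b) ∧ f 1 = 1

/-- `f : A → A` is a `K`-algebra automorphism: a bijective endomorphism. -/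
def IsAlgAuto (K : Type) [CommSemiring K] {A : Type} [Semiring A] [Algebra K A]
    (f : A → A) : Prop :=
  IsAlgEndo K f ∧ Function.Bijective f

/-- `f : A → A` is a `K`-linear anti-endomorphism. -/
def IsAntiEndo (K : Type) [CommSemiring K] {A : Type} [Semiring A] [Algebra K A]
    (f : A → A) : Prop :=
  (∀ a b : A, f (a + b) = f a + f b) ∧
  (∀ (c : K) (a : A), f (c • a) = c • f a) ∧
  (∀ a b : A, f (a * b) = f b * f a) ∧ f 1 = 1

/-- `f : A → A` is an anti-automorphism: a bijective anti-endomorphism. -/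
def IsAntiAuto (K : Type) [CommSemiring K] {A : Type} [Semiring A] [Algebra K A]
    (f : A → A) : Prop :=
  IsAntiEndo K f ∧ Function.Bijective f

/-- An involution on a `K`-algebra: an anti-automorphism of order at most two. -/
def IsInvolutionOn (K : Type) [CommSemiring K] {A : Type} [Semiring A] [Algebra K A]
    (γ : A → A) : Prop :=
  IsAntiAuto K γ ∧ γ ∘ γ = id

/-- The defining relation of the first Weyl algebra: `Y*X = X*Y + 1`. -/
inductive WeylRel (K : Type) [CommSemiring K] :
    FreeAlgebra K (Fin 2) → FreeAlgebra K (Fin 2) → Prop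
  | rel : WeylRel K (FreeAlgebra.ι K 1 * FreeAlgebra.ι K 0)
      (FreeAlgebra.ι K 0 * FreeAlgebra.ι K 1 + 1)

/-- The first Weyl algebra `A₁(K) = K⟨X,Y⟩/(YX - XY - 1)`. -/
abbrev Weyl (K : Type) [CommSemiring K] : Type := RingQuot (WeylRel K)

/-- The generator `X` of the Weyl algebra. -/
def Wx (K : Type) [CommSemiring K] : Weyl K :=
  RingQuot.mkAlgHom K (WeylRel K) (FreeAlgebra.ι K 0)

/-- The generator `Y` of the Weyl algebra. -/
def Wy (K : Type) [CommSemiring K] : Weyl K :=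
  RingQuot.mkAlgHom K (WeylRel K) (FreeAlgebra.ι K 1)

/-- `α` is the exchange involution: the involution with `α X = Y` and `α Y = X`. -/
def IsExchange (K : Type) [CommSemiring K] (α : Weyl K → Weyl K) : Prop :=
  IsInvolutionOn K α ∧ α (Wx K) = Wy K ∧ α (Wy K) = Wx K

/-- `γ` is conjugate to `α` by an automorphism or an anti-automorphism:
`γ = g⁻¹ ∘ α ∘ g`. -/
def ConjToAlpha (K : Type) [CommSemiring K] (α γ : Weyl K → Weyl K) : Prop :=
  ∃ g : Weyl K → Weyl K, (IsAlgAuto K g ∨ IsAntiAuto K g) ∧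
    γ = Function.invFun g ∘ α ∘ g


section GenericPart
open Polynomial

theorem wcomm_pow {R : Type*} [Ring R] {a b : R} (h : b * a = a * b + 1) (n : ℕ) :
    b * a ^ n = a ^ n * b + n * a ^ (n - 1) := by
  induction n with
  | zero => simp
  | succ n ih =>
    have e : (n : R) * a ^ (n - 1) * a = n * a ^ n := by
      rcases n with _ | n
      · simp
      · simp [mul_assoc, pow_succ]
    calc b * a ^ (n+1) = (b * a ^ n) * a := by rw [pow_succ, mul_assoc]
      _ = a ^ n * (b * a) + n * a ^ (n-1) * a := by rw [ih, add_mul, mul_assoc]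
      _ = a ^ (n+1) * b + ((n+1 : ℕ) : R) * a ^ (n + 1 - 1) := by
        rw [h, e, pow_succ]; push_cast
        rw [mul_add, add_mul (n : R), mul_one, one_mul, mul_assoc]; abel

/-- the derivation `[b, ·]` -/
def adL {R : Type*} [Ring R] (b : R) : Module.End ℤ R :=
  LinearMap.mulLeft ℤ b - LinearMap.mulRight ℤ b

theorem adL_apply {R : Type*} [Ring R] (b x : R) : adL b x = b * x - x * b := by
  simp [adL]

theorem adL_pow {R : Type*} [Ring R] {a b : R} (h : b * a = a * b + 1) (m k : ℕ) :
    ((adL b) ^ k) (a ^ m) = (m.descFactorial k : R) * a ^ (m - k) := by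
  induction k with
  | zero => simp
  | succ k ih =>
    rw [pow_succ', Module.End.mul_apply, ih, adL_apply, ← mul_assoc, ← Nat.cast_comm, mul_assoc,
      wcomm_pow h, mul_add, Nat.descFactorial_succ]
    have : m - k - 1 = m - (k+1) := by omega
    rw [this]; push_cast
    rw [mul_assoc, ← mul_assoc _ _ (a ^ (m - (k+1)))]
    rw [add_sub_cancel_left, ← Nat.cast_mul, ← Nat.cast_mul, mul_comm]

theorem wcomm_pow_pow {R : Type*} [Ring R] {a b : R} (h : b * a = a * b + 1) (m n : ℕ) :
    b ^ n * a ^ m = ∑ k ∈ Finset.range (n + 1),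
      ((n.choose k * m.descFactorial k : ℕ) : R) * (a ^ (m - k) * b ^ (n - k)) := by
  have hc : Commute (adL b) (LinearMap.mulRight ℤ b) := by
    ext x; simp [adL_apply, sub_mul, mul_assoc]
  have h1 : LinearMap.mulLeft ℤ b = adL b + LinearMap.mulRight ℤ b := by simp [adL]
  have h2 : b ^ n * a ^ m = ((LinearMap.mulLeft ℤ b) ^ n) (a ^ m) := by
    rw [LinearMap.pow_mulLeft]; simp
  rw [h2, h1, hc.add_pow, LinearMap.sum_apply]
  refine Finset.sum_congr rfl fun k _ => ?_
  rw [(hc.pow_pow k (n-k)).eq, mul_assoc, Module.End.mul_apply, Module.End.mul_apply,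
    LinearMap.pow_mulRight]
  have : ((n.choose k : ℕ) : Module.End ℤ R) (a ^ m) = n.choose k • a ^ m := by
    simp
  rw [this, map_nsmul, adL_pow h, map_nsmul, LinearMap.mulRight_apply, nsmul_eq_mul]
  push_cast
  simp only [mul_assoc]

theorem wcomm_prime {R : Type*} [Ring R] {a b : R} (h : b * a = a * b + 1) {l : ℕ}
    (hl : l.Prime) :
    ∃ r : R, b ^ l * a ^ l - a ^ l * b ^ l = (l.factorial : R) + (l : R) ^ 2 * r := by
  have key : ∀ k ∈ Finset.range (l - 1), ∃ c : ℕ,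
      l.choose (k+1) * l.descFactorial (k+1) = l ^ 2 * c := by
    intro k hk
    have hk' := Finset.mem_range.mp hk
    have h1 : l ∣ l.choose (k+1) := hl.dvd_choose_self (by omega) (by omega)
    have h2 : l ∣ l.descFactorial (k+1) := by
      obtain ⟨n, rfl⟩ : ∃ n, l = n + 1 := ⟨l - 1, by have := hl.pos; omega⟩
      rw [Nat.succ_descFactorial_succ]; exact dvd_mul_right _ _
    obtain ⟨c, hc⟩ := mul_dvd_mul h1 h2
    exact ⟨c, by rw [hc, sq]⟩
  choose! c hc using key
  refine ⟨∑ k ∈ Finset.range (l - 1), (c k : R) * (a ^ (l - (k+1)) * b ^ (l - (k+1))), ?_⟩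
  have e1 : l + 1 = (l - 1) + 1 + 1 := by have := hl.pos; omega
  rw [wcomm_pow_pow h, e1, Finset.sum_range_succ, Finset.sum_range_succ']
  have e2 : l - 1 + 1 = l := by have := hl.pos; omega
  rw [e2, Finset.mul_sum]
  simp only [Nat.choose_self, Nat.descFactorial_self, Nat.sub_self, pow_zero, mul_one,
    Nat.choose_zero_right, Nat.descFactorial_zero, Nat.cast_one, one_mul, Nat.sub_zero]
  rw [Finset.sum_congr rfl (g := fun k => (l : R)^2 * ((c k : R) *
    (a ^ (l - (k+1)) * b ^ (l - (k+1)))))]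
  · abel
  · intro k hk
    rw [hc k hk]; push_cast; rw [mul_assoc]

theorem adq_aeval {R E : Type*} [CommRing R] [Ring E] [Algebra R E] {p q : E}
    (h : q * p = p * q + 1) (g : R[X]) :
    q * aeval p g - aeval p g * q = aeval p (derivative g) := by
  induction g using Polynomial.induction_on' with
  | add f g hf hg => rw [map_add, map_add, map_add, ← hf, ← hg]; noncomm_ring
  | monomial n r =>
    rw [derivative_monomial, aeval_monomial, aeval_monomial, ← mul_assoc,
      ← Algebra.commutes r q, mul_assoc, wcomm_pow h, mul_add, map_mul, map_natCast]
    rw [mul_assoc, add_sub_cancel_left, mul_assoc]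

theorem CH_zero {R E : Type*} [CommRing R] [Ring E] [Algebra R E] {p q : E}
    (h : q * p = p * q + 1) {l : ℕ} (hl : l.Prime) (hR : (l : R) = 0) (n : ℕ) :
    n < l → ∀ g : R[X], g.natDegree ≤ n → aeval p g = 0 →
      ∀ i, algebraMap R E (g.coeff i) = 0 := by
  have hun : ∀ i : ℕ, 0 < i → i < l → IsUnit ((i : R)) := by
    intro i h0 hi
    have : Nat.Coprime i l := (Nat.coprime_comm.mp ((Nat.Prime.coprime_iff_not_dvd hl).mpr
      (fun hd => absurd (Nat.le_of_dvd h0 hd) (by omega))))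
    have h3 := (Nat.isCoprime_iff_coprime.mpr this)
    obtain ⟨a, b, hab⟩ := h3
    have := congrArg (Int.cast : ℤ → R) hab
    push_cast at this
    rw [hR, mul_zero, add_zero, mul_comm] at this
    exact IsUnit.of_mul_eq_one _ this
  induction n with
  | zero =>
    intro _ g hg h0 i
    rw [eq_C_of_natDegree_le_zero hg, aeval_C] at h0
    rcases i with _ | i
    · exact h0
    · rw [coeff_eq_zero_of_natDegree_lt (by omega), map_zero]
  | succ n ih =>
    intro hn g hg h0
    have hd : ∀ i, algebraMap R E ((derivative g).coeff i) = 0 := by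
      apply ih (by omega)
      · exact (natDegree_derivative_le g).trans (by omega)
      · rw [← adq_aeval h, h0]; simp
    have hs : ∀ i, algebraMap R E (g.coeff (i+1)) = 0 := by
      intro i
      by_cases hi : i + 1 < l
      · have := hd i
        rw [coeff_derivative, map_mul] at this
        have hu := (hun (i+1) (by omega) hi).map (algebraMap R E)
        rw [Nat.cast_add, Nat.cast_one] at hu
        rwa [hu.mul_left_eq_zero] at this
      · rw [coeff_eq_zero_of_natDegree_lt (by omega), map_zero]
    intro i
    rcases i with _ | i
    · rw [aeval_eq_sum_range, Finset.sum_range_succ'] at h0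
      simp only [Algebra.smul_def, hs, zero_mul, Finset.sum_const_zero, zero_add, pow_zero,
        mul_one] at h0
      exact h0
    · exact hs i

theorem CH_pow {R E : Type*} [CommRing R] [Ring E] [Algebra R E] {p q : E}
    (h : q * p = p * q + 1) {l : ℕ} (hl : l.Prime) (hR : (l : R) = 0)
    (m : R[X]) (hm : m.Monic) (hd : m.natDegree ≤ l) (h0 : aeval p m = 0) :
    ∃ c : R, p ^ l = algebraMap R E c := by
  rcases subsingleton_or_nontrivial R with hs | hs
  · have : (1 : E) = 0 := by
      rw [← map_one (algebraMap R E), Subsingleton.elim (1 : R) 0, map_zero]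
    exact ⟨0, by rw [← one_mul (p ^ l), this]; simp⟩
  set g : R[X] := m * X ^ (l - m.natDegree) with hg
  have hgm : g.Monic := hm.mul (monic_X_pow _)
  have hgd : g.natDegree = l := by
    rw [hg, hm.natDegree_mul (monic_X_pow _), natDegree_X_pow]; omega
  have hg0 : aeval p g = 0 := by rw [hg, map_mul, h0, zero_mul]
  set r := g - X ^ l with hr
  have hrd : r.degree < l := by
    have := degree_sub_lt_left (p := g) (q := X ^ l) (by
      rw [degree_X_pow, degree_eq_natDegree hgm.ne_zero, hgd]) hgm.ne_zero (by
      rw [hgm.leadingCoeff, (monic_X_pow l).leadingCoeff])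
    rwa [degree_eq_natDegree hgm.ne_zero, hgd] at this
  have hrd' : (derivative r).natDegree ≤ l - 1 := by
    refine (natDegree_derivative_le r).trans ?_
    have : r.natDegree ≤ l := natDegree_le_of_degree_le hrd.le
    omega
  have hdr : aeval p (derivative r) = 0 := by
    have : derivative r = derivative g := by
      rw [hr, derivative_sub, derivative_X_pow, hR]; simp
    rw [this, ← adq_aeval h, hg0]; simp
  have hz := CH_zero h hl hR (l-1) (by have := hl.pos; omega) _ hrd' hdr
  have hs : ∀ i, algebraMap R E (r.coeff (i+1)) = 0 := by
    intro i
    by_cases hi : i + 1 < l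
    · have := hz i
      rw [coeff_derivative, map_mul] at this
      have hu : IsUnit ((i + 1 : ℕ) : R) := by
        have : Nat.Coprime (i+1) l := (Nat.coprime_comm.mp ((Nat.Prime.coprime_iff_not_dvd hl).mpr
          (fun hd => absurd (Nat.le_of_dvd (by omega) hd) (by omega))))
        obtain ⟨a, b, hab⟩ := (Nat.isCoprime_iff_coprime.mpr this)
        have := congrArg (Int.cast : ℤ → R) hab
        push_cast at this
        rw [hR, mul_zero, add_zero, mul_comm] at this
        push_cast
        exact IsUnit.of_mul_eq_one _ this
      have hu := hu.map (algebraMap R E)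
      rw [Nat.cast_add, Nat.cast_one] at hu
      rwa [hu.mul_left_eq_zero] at this
    · rw [coeff_eq_zero_of_degree_lt (hrd.trans_le (by exact_mod_cast (by omega : l ≤ i+1))),
        map_zero]
  have hr1 : aeval p r = algebraMap R E (r.coeff 0) := by
    rw [aeval_eq_sum_range, Finset.sum_range_succ']
    simp only [Algebra.smul_def, hs, zero_mul, Finset.sum_const_zero, zero_add, pow_zero,
      mul_one]
  refine ⟨- r.coeff 0, ?_⟩
  rw [map_neg, ← hr1, hr, map_sub, hg0, map_pow, aeval_X]; simp

end GenericPart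


section WeylPart
open Polynomial

variable {S : Type} [CommRing S]

theorem wrel : Wy S * Wx S = Wx S * Wy S + 1 := by
  have := RingQuot.mkAlgHom_rel S (WeylRel.rel (K := S))
  simpa [Wx, Wy] using this

def wlift {S : Type} [CommRing S] {B : Type*} [Ring B] [Algebra S B] (a b : B)
    (h : b * a = a * b + 1) : Weyl S →ₐ[S] B :=
  RingQuot.liftAlgHom S ⟨FreeAlgebra.lift S ![a, b], by
    intro x y hxy
    cases hxy
    simp [h]⟩

theorem wlift_x {B : Type*} [Ring B] [Algebra S B] (a b : B)
    (h : b * a = a * b + 1) : wlift (S := S) a b h (Wx S) = a := by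
  simp [wlift, Wx]

theorem wlift_y {B : Type*} [Ring B] [Algebra S B] (a b : B)
    (h : b * a = a * b + 1) : wlift (S := S) a b h (Wy S) = b := by
  simp [wlift, Wy]

theorem whom_ext {B : Type*} [Ring B] [Algebra S B] {f g : Weyl S →ₐ[S] B}
    (hx : f (Wx S) = g (Wx S)) (hy : f (Wy S) = g (Wy S)) : f = g := by
  apply RingQuot.ringQuot_ext'
  apply FreeAlgebra.hom_ext
  funext i
  fin_cases i
  · exact hx
  · exact hy

theorem wsub_top (A : Subalgebra S (Weyl S)) (hx : Wx S ∈ A) (hy : Wy S ∈ A) (w : Weyl S) :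
    w ∈ A := by
  let φ : Weyl S →ₐ[S] A := wlift (B := A) (⟨Wx S, hx⟩ : A) (⟨Wy S, hy⟩ : A)
    (Subtype.ext wrel)
  have : A.val.comp φ = AlgHom.id S (Weyl S) := by
    apply whom_ext
    · simp [φ, wlift_x]
    · simp [φ, wlift_y]
  have h2 := congrArg (fun f => f w) this
  simp only [AlgHom.comp_apply, AlgHom.id_apply] at h2
  rw [← h2]
  exact (φ w).2

/-- operator of multiplication by `x` -/
def opU (S : Type) [CommRing S] : Module.End S (S[X][X]) := LinearMap.mulLeft S X
/-- operator `y + d/dx` -/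
def opV (S : Type) [CommRing S] : Module.End S (S[X][X]) :=
  LinearMap.mulLeft S (C X) + (derivative (R := S[X])).restrictScalars S

theorem opU_apply (f : S[X][X]) : opU S f = X * f := rfl
theorem opV_apply (f : S[X][X]) : opV S f = C X * f + derivative f := rfl

def rho (S : Type) [CommRing S] : Weyl S →ₐ[S] Module.End S (S[X][X]) :=
  wlift (opU S) (opV S) (by
    apply LinearMap.ext
    intro f
    simp only [Module.End.mul_apply, LinearMap.add_apply, opU_apply, opV_apply,
      Module.End.one_apply, derivative_mul, derivative_X]
    ring)

theorem rho_x (f : S[X][X]) : rho S (Wx S) f = X * f := by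
  rw [rho, wlift_x, opU_apply]
theorem rho_y (f : S[X][X]) : rho S (Wy S) f = C X * f + derivative f := by
  rw [rho, wlift_y, opV_apply]

def sg (w : Weyl S) : S[X][X] := rho S w 1

theorem sg_mul (a b : Weyl S) : sg (a * b) = rho S a (sg b) := by
  simp [sg]
theorem sg_add (a b : Weyl S) : sg (a + b) = sg a + sg b := by
  simp [sg]
theorem sg_sub (a b : Weyl S) : sg (a - b) = sg a - sg b := by
  simp [sg]
theorem sg_smul (c : S) (b : Weyl S) : sg (c • b) = c • sg b := by
  simp [sg]
theorem sg_zero : sg (0 : Weyl S) = 0 := by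
  simp [sg]
theorem sg_one : sg (1 : Weyl S) = 1 := by
  simp [sg]

def NN : S[X][X] →ₗ[S] Weyl S :=
  lsum (fun i => (LinearMap.mulLeft S (Wx S ^ i)) ∘ₗ (aeval (Wy S)).toLinearMap)

theorem NN_monomial (i : ℕ) (a : S[X]) :
    NN (monomial i a) = Wx S ^ i * aeval (Wy S) a := by
  simp [NN, lsum_apply, sum_monomial_index]

theorem NN_one : NN (1 : S[X][X]) = 1 := by
  rw [← monomial_zero_one, NN_monomial]; simp

theorem NN_x (f : S[X][X]) : NN (X * f) = Wx S * NN f := by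
  induction f using Polynomial.induction_on' with
  | add f g hf hg => rw [mul_add, map_add, hf, hg, map_add, mul_add]
  | monomial i a =>
    rw [X_mul_monomial, NN_monomial, NN_monomial, pow_succ', mul_assoc]

theorem NN_y (f : S[X][X]) : NN (C X * f + derivative f) = Wy S * NN f := by
  induction f using Polynomial.induction_on' with
  | add f g hf hg =>
    rw [map_add NN f g, mul_add (Wy S), ← hf, ← hg, ← map_add]; congr 1
    rw [derivative_add]; ring
  | monomial i a =>
    rw [C_mul_monomial, derivative_monomial, map_add, NN_monomial, NN_monomial, NN_monomial,
      ← mul_assoc (Wy S), wcomm_pow wrel, map_mul, map_mul, aeval_X, map_natCast,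
      ← Nat.cast_comm, add_mul]
    simp only [mul_assoc]
    congr 1
    rw [← mul_assoc, ← mul_assoc, Nat.cast_comm]

theorem NN_yr (f : S[X][X]) : NN (C X * f) = NN f * Wy S := by
  induction f using Polynomial.induction_on' with
  | add f g hf hg => rw [mul_add, map_add, hf, hg, map_add, add_mul]
  | monomial i a =>
    rw [C_mul_monomial, NN_monomial, NN_monomial, mul_comm, map_mul, aeval_X, mul_assoc]

theorem NN_rho (w : Weyl S) (f : S[X][X]) : NN (rho S w f) = w * NN f := by
  let A : Subalgebra S (Weyl S) :=
    { carrier := {w | ∀ f, NN (rho S w f) = w * NN f}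
      mul_mem' := by
        intro a b ha hb f
        rw [map_mul, Module.End.mul_apply, ha, hb, mul_assoc]
      add_mem' := by
        intro a b ha hb f
        rw [map_add, LinearMap.add_apply, map_add, ha, hb, add_mul]
      algebraMap_mem' := by
        intro r f
        rw [AlgHom.commutes, Module.algebraMap_end_apply, map_smul, Algebra.smul_def] }
  exact wsub_top A (fun f => by rw [rho_x, NN_x]) (fun f => by rw [rho_y, NN_y]) w f

theorem NN_sg (w : Weyl S) : NN (sg w) = w := by
  rw [sg, NN_rho, NN_one, mul_one]

theorem rho_xpow (i : ℕ) (f : S[X][X]) : rho S (Wx S ^ i) f = X ^ i * f := by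
  induction i with
  | zero => simp
  | succ n ih => rw [pow_succ', map_mul, Module.End.mul_apply, ih, rho_x, pow_succ', mul_assoc]

theorem rho_ypoly (a b : S[X]) : rho S (aeval (Wy S) a) (C b) = C (a * b) := by
  induction a using Polynomial.induction_on' with
  | add f g hf hg => rw [map_add, map_add, LinearMap.add_apply, hf, hg, ← C_add, add_mul]
  | monomial i a =>
    rw [aeval_monomial, map_mul, Module.End.mul_apply, AlgHom.commutes,
      Module.algebraMap_end_apply]
    have : ∀ i, rho S (Wy S ^ i) (C b) = C (X ^ i * b) := by
      intro i
      induction i with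
      | zero => simp
      | succ n ih =>
        rw [pow_succ', map_mul, Module.End.mul_apply, ih, rho_y, derivative_C, add_zero, ← C_mul,
          pow_succ', mul_assoc]
    rw [this, smul_C]
    congr 1
    rw [← C_mul_X_pow_eq_monomial, smul_eq_C_mul, mul_assoc]

theorem sg_NN (f : S[X][X]) : sg (NN f) = f := by
  induction f using Polynomial.induction_on' with
  | add f g hf hg => rw [map_add, sg_add, hf, hg]
  | monomial i a =>
    rw [NN_monomial, sg_mul, sg, ← C_1, rho_ypoly, mul_one, rho_xpow, ← C_mul_X_pow_eq_monomial,
      mul_comm]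

theorem sg_inj {a b : Weyl S} (h : sg a = sg b) : a = b := by
  rw [← NN_sg a, ← NN_sg b, h]

/-- coefficient of `x^i y^j` -/
def cf (w : Weyl S) (i j : ℕ) : S := ((sg w).coeff i).coeff j

theorem cf_ext {a b : Weyl S} (h : ∀ i j, cf a i j = cf b i j) : a = b := by
  apply sg_inj
  ext i j
  exact h i j

theorem cf_add (a b : Weyl S) (i j : ℕ) : cf (a + b) i j = cf a i j + cf b i j := by
  simp [cf, sg_add]
theorem cf_sub (a b : Weyl S) (i j : ℕ) : cf (a - b) i j = cf a i j - cf b i j := by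
  simp [cf, sg_sub]
theorem cf_smul (c : S) (b : Weyl S) (i j : ℕ) : cf (c • b) i j = c * cf b i j := by
  simp [cf, sg_smul]
theorem cf_zero (i j : ℕ) : cf (0 : Weyl S) i j = 0 := by
  simp [cf, sg_zero]
theorem cf_sum {ι : Type*} (s : Finset ι) (g : ι → Weyl S) (i j : ℕ) :
    cf (∑ k ∈ s, g k) i j = ∑ k ∈ s, cf (g k) i j := by
  classical
  induction s using Finset.induction_on with
  | empty => simp [cf_zero]
  | insert a s ha ih => rw [Finset.sum_insert ha, Finset.sum_insert ha, cf_add, ih]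

theorem sg_mono (a b : ℕ) : sg (Wx S ^ a * Wy S ^ b) = monomial a (X ^ b) := by
  rw [← sg_NN (monomial a (X ^ b)), NN_monomial]; simp

theorem cf_mono (a b i j : ℕ) :
    cf (Wx S ^ a * Wy S ^ b) i j = if a = i ∧ b = j then 1 else 0 := by
  rw [cf, sg_mono, coeff_monomial]
  by_cases h : a = i
  · simp [h, coeff_X_pow, eq_comm]
  · simp [h]

theorem w_expand (w : Weyl S) (m n : ℕ) (h : ∀ i j, m ≤ i ∨ n ≤ j → cf w i j = 0) :
    w = ∑ i ∈ Finset.range m, ∑ j ∈ Finset.range n, cf w i j • (Wx S ^ i * Wy S ^ j) := by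
  apply cf_ext
  intro i j
  simp only [cf_sum, cf_smul, cf_mono]
  by_cases hi : i < m
  · rw [Finset.sum_eq_single i]
    · by_cases hj : j < n
      · rw [Finset.sum_eq_single j]
        · simp
        · intro b _ hb; simp [hb]
        · intro hb; simp [hj] at hb
      · rw [h i j (by omega), Finset.sum_eq_zero]
        intro k hk
        have := Finset.mem_range.mp hk
        rw [if_neg (by omega), mul_zero]
    · intro b _ hb; simp [hb]
    · intro hb; simp [hi] at hb
  · rw [h i j (by omega), Finset.sum_eq_zero]
    intro k hk
    rw [Finset.sum_eq_zero]
    intro k2 _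
    have := Finset.mem_range.mp hk
    rw [if_neg (by omega), mul_zero]

theorem cf_bound (w : Weyl S) : ∃ D : ℕ, ∀ i j, D ≤ i ∨ D ≤ j → cf w i j = 0 := by
  classical
  refine ⟨(sg w).natDegree + 1 + (sg w).support.sup (fun i => ((sg w).coeff i).natDegree + 1), ?_⟩
  intro i j h
  by_cases hi : i ∈ (sg w).support
  · have h1 := le_natDegree_of_mem_supp i hi
    have h2 := Finset.le_sup (f := fun i => ((sg w).coeff i).natDegree + 1) hi
    have h3 : ((sg w).coeff i).natDegree + 1 ≤
      (sg w).support.sup (fun i => ((sg w).coeff i).natDegree + 1) := h2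
    clear h2
    exact coeff_eq_zero_of_natDegree_lt (by omega)
  · rw [notMem_support_iff] at hi
    simp [cf, hi]

/-- base change -/
def wmap (S S' : Type) [CommRing S] [CommRing S'] [Algebra S S'] : Weyl S →ₐ[S] Weyl S' :=
  wlift (Wx S') (Wy S') wrel

section
variable {S' : Type} [CommRing S'] [Algebra S S']
theorem wmap_x : wmap S S' (Wx S) = Wx S' := wlift_x _ _ _
theorem wmap_y : wmap S S' (Wy S) = Wy S' := wlift_y _ _ _

theorem walg (s : S) : algebraMap S (Weyl S') s = algebraMap S' (Weyl S') (algebraMap S S' s) := by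
  rfl

theorem wmap_smul (s : S) (w : Weyl S) :
    wmap S S' (s • w) = algebraMap S S' s • wmap S S' w := by
  rw [Algebra.smul_def, map_mul, AlgHom.commutes, walg, Algebra.smul_def]

theorem cf_wmap (w : Weyl S) (i j : ℕ) : cf (wmap S S' w) i j = algebraMap S S' (cf w i j) := by
  obtain ⟨D, hD⟩ := cf_bound w
  have := w_expand w D D hD
  conv_lhs => rw [this]
  conv_rhs => rw [this]
  simp only [map_sum, cf_sum, wmap_smul, cf_smul, map_mul, map_pow, wmap_x, wmap_y, cf_mono]
  simp only [apply_ite (algebraMap S S'), map_one, map_zero]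
end

end WeylPart


section Central
open Polynomial

variable {S : Type} [CommRing S]

theorem cf_comm_y (w : Weyl S) (i j : ℕ) :
    cf (Wy S * w - w * Wy S) i j = (i + 1 : ℕ) * cf w (i + 1) j := by
  have h : Wy S * w - w * Wy S = NN (derivative (sg w)) := by
    have h1 := NN_y (sg w)
    have h2 := NN_yr (sg w)
    rw [map_add, h2, NN_sg] at h1
    rw [← h1]; abel
  rw [h, cf, sg_NN, coeff_derivative, cf]
  have : ((i : S[X]) + 1) = C ((i + 1 : ℕ) : S) := by simp
  rw [this, coeff_mul_C, mul_comm]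

theorem cf_comm_x (w : Weyl S) (i j : ℕ) :
    cf (w * Wx S - Wx S * w) i j = (j + 1 : ℕ) * cf w i (j + 1) := by
  have key : ∀ a b : ℕ, Wx S ^ a * Wy S ^ b * Wx S - Wx S * (Wx S ^ a * Wy S ^ b) =
      (b : S) • (Wx S ^ a * Wy S ^ (b - 1)) := by
    intro a b
    have h2 : Wy S ^ b * Wx S = Wx S * Wy S ^ b + b * Wy S ^ (b - 1) := by
      induction b with
      | zero => simp
      | succ n ih =>
        rw [pow_succ, mul_assoc, wrel, mul_add, ← mul_assoc, ih]
        rcases n with _ | n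
        · simp
        · simp only [Nat.add_sub_cancel, pow_succ, Nat.cast_add, Nat.cast_one]
          noncomm_ring
    rw [mul_assoc, h2, mul_add, ← mul_assoc, ← mul_assoc (Wx S), ← pow_succ, ← pow_succ',
      add_sub_cancel_left, Algebra.smul_def, map_natCast, ← mul_assoc, ← mul_assoc, Nat.cast_comm]
  obtain ⟨D, hD⟩ := cf_bound w
  have := w_expand w D D hD
  have e : w * Wx S - Wx S * w = ∑ i ∈ Finset.range D, ∑ j ∈ Finset.range D,
      (cf w i j * j) • (Wx S ^ i * Wy S ^ (j - 1)) := by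
    conv_lhs => rw [this]
    simp only [Finset.sum_mul, Finset.mul_sum, ← Finset.sum_sub_distrib]
    refine Finset.sum_congr rfl fun a _ => Finset.sum_congr rfl fun b _ => ?_
    rw [smul_mul_assoc, mul_smul_comm, mul_smul, ← key, Algebra.smul_def, Algebra.smul_def,
      Algebra.smul_def, mul_sub]
  rw [e]
  conv_rhs => rw [this]
  simp only [cf_sum, cf_smul, cf_mono, Finset.mul_sum]
  refine Finset.sum_congr rfl fun a _ => Finset.sum_congr rfl fun b _ => ?_
  rcases b with _ | b
  · simp
  · by_cases h : a = i ∧ b = j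
    · obtain ⟨rfl, rfl⟩ := h; simp [mul_comm]
    · have h' : ¬ (a = i ∧ b + 1 = j + 1) := by omega
      have h2 : ¬ (a = i ∧ b + 1 - 1 = j) := by omega
      rw [if_neg h2, if_neg h']; simp

variable {l : ℕ}

theorem isUnit_of_not_dvd (hl : l.Prime) (hS : (l : S) = 0) {i : ℕ} (hi : ¬ l ∣ i) :
    IsUnit (i : S) := by
  have : IsCoprime (i : ℤ) (l : ℤ) := by
    rw [Nat.isCoprime_iff_coprime]
    exact ((Nat.Prime.coprime_iff_not_dvd hl).2 hi).symm
  obtain ⟨a, b, h⟩ := this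
  have h2 := congrArg (Int.cast : ℤ → S) h
  push_cast at h2
  rw [hS, mul_zero, add_zero] at h2
  exact IsUnit.of_mul_eq_one _ (by rw [mul_comm]; exact h2)

theorem cent_cf (hl : l.Prime) (hS : (l : S) = 0) (w : Weyl S) (hx : w * Wx S = Wx S * w)
    (hy : w * Wy S = Wy S * w) (i j : ℕ) (h : ¬ (l ∣ i ∧ l ∣ j)) : cf w i j = 0 := by
  by_cases hi : l ∣ i
  · have hj : ¬ l ∣ j := fun hj => h ⟨hi, hj⟩
    rcases j with _ | j
    · simp at hj
    have := cf_comm_x w i j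
    rw [hx, sub_self, cf_zero] at this
    exact ((isUnit_of_not_dvd hl hS hj).mul_right_eq_zero).1 this.symm
  · rcases i with _ | i
    · simp at hi
    have := cf_comm_y w i j
    rw [hy, sub_self, cf_zero] at this
    exact ((isUnit_of_not_dvd hl hS hi).mul_right_eq_zero).1 this.symm

/-- the ring of polynomials in `X^l` -/
abbrev RR (S : Type) [CommRing S] (l : ℕ) : Subalgebra S[X] (S[X][X]) := (expand S[X] l).range

theorem RR_der (hS : (l : S) = 0) (r : RR S l) : derivative (r : S[X][X]) = 0 := by
  obtain ⟨r, g, rfl⟩ := r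
  have : (l : S[X][X]) = 0 := by
    rw [← map_natCast (C : S[X] →+* S[X][X]), ← map_natCast (C : S →+* S[X]), hS]; simp
  change derivative (expand S[X] l g) = 0
  rw [derivative_expand, this]; simp

def opUR (S : Type) [CommRing S] (l : ℕ) : Module.End (RR S l) (S[X][X]) :=
  LinearMap.mulLeft (RR S l) X

def opVR (S : Type) [CommRing S] (l : ℕ) (hS : (l : S) = 0) : Module.End (RR S l) (S[X][X]) where
  toFun f := C X * f + derivative f
  map_add' f g := by rw [derivative_add]; ring
  map_smul' r f := by
    change C X * ((r : S[X][X]) * f) + derivative ((r : S[X][X]) * f) = (r : S[X][X]) * _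
    rw [derivative_mul, RR_der hS r]; ring

def rhoR (S : Type) [CommRing S] (l : ℕ) (hS : (l : S) = 0) :
    Weyl S →ₐ[S] Module.End (RR S l) (S[X][X]) :=
  wlift (opUR S l) (opVR S l hS) (by
    apply LinearMap.ext
    intro f
    change C X * (X * f) + derivative (X * f) = X * (C X * f + derivative f) + f
    simp only [derivative_mul, derivative_X]
    ring)

theorem rhoR_eq (hS : (l : S) = 0) (w : Weyl S) (f : S[X][X]) : rhoR S l hS w f = rho S w f := by
  let A : Subalgebra S (Weyl S) :=
    { carrier := {w | ∀ f, rhoR S l hS w f = rho S w f}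
      mul_mem' := by
        intro a b ha hb f
        rw [map_mul, map_mul, Module.End.mul_apply, Module.End.mul_apply, ha, hb]
      add_mem' := by
        intro a b ha hb f
        rw [map_add, map_add, LinearMap.add_apply, LinearMap.add_apply, ha, hb]
      algebraMap_mem' := by
        intro r f
        rw [AlgHom.commutes, AlgHom.commutes, Module.algebraMap_end_apply]
        rfl }
  exact wsub_top A (fun f => by rw [rho_x, rhoR, wlift_x]; rfl)
    (fun f => by rw [rho_y, rhoR, wlift_y]; rfl) w f

theorem RR_span (hl : 0 < l) :
    (⊤ : Submodule (RR S l) (S[X][X])) =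
      Submodule.span _ ((fun i : ℕ => (X : S[X][X]) ^ i) '' (Finset.range l : Set ℕ)) := by
  symm
  rw [eq_top_iff]
  intro f _
  induction f using Polynomial.induction_on' with
  | add f g hf hg => exact Submodule.add_mem _ (hf trivial) (hg trivial)
  | monomial i a =>
    have : monomial i a = (⟨expand S[X] l (monomial (i / l) a), ⟨monomial (i / l) a, rfl⟩⟩ : RR S l) •
        (X : S[X][X]) ^ (i % l) := by
      change _ = expand S[X] l (monomial (i / l) a) * _
      rw [expand_monomial, monomial_mul_X_pow]
      congr 1
      rw [mul_comm, Nat.div_add_mod]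
    rw [this]
    apply Submodule.smul_mem
    apply Submodule.subset_span
    exact ⟨i % l, by simpa using Nat.mod_lt _ hl, rfl⟩

theorem gen_CH {R M : Type*} [CommRing R] [AddCommGroup M] [Module R M] (hl : l.Prime)
    (hR : (l : R) = 0) (g : ℕ → M)
    (hsp : (⊤ : Submodule R M) = Submodule.span R (g '' (Finset.range l : Set ℕ)))
    (f q : Module.End R M) (h : q * f = f * q + 1) :
    ∃ c : R, ∀ x, (f ^ l) x = c • x := by
  classical
  have hfin : Module.Finite R M :=
    ⟨⟨(Finset.range l).image g, by rw [hsp, Finset.coe_image]⟩⟩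
  obtain ⟨m, hm, hd, h0⟩ := LinearMap.exists_monic_and_natDegree_eq_and_aeval_eq_zero R f
  have hd2 : m.natDegree ≤ l := by
    rw [hd, hsp]
    refine (Submodule.spanFinrank_span_le_ncard_of_finite ?_).trans ?_
    · exact (Finset.finite_toSet _).image _
    · exact (Set.ncard_image_le (Finset.finite_toSet _)).trans
        (by rw [Set.ncard_coe_finset, Finset.card_range])
  obtain ⟨c, hc⟩ := CH_pow h hl hR m hm hd2 h0
  exact ⟨c, fun x => by rw [hc, Module.algebraMap_end_apply]⟩

theorem RR_l (hS : (l : S) = 0) : (l : RR S l) = 0 := by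
  have : ((l : S[X][X])) = 0 := by
    rw [← map_natCast (C : S[X] →+* S[X][X]), ← map_natCast (C : S →+* S[X]), hS, map_zero,
      map_zero]
  exact Subtype.ext this

theorem cent_scalar (hl : l.Prime) (hS : (l : S) = 0) (p q : Weyl S) (h : q * p = p * q + 1) :
    ∃ c : RR S l, ∀ f, rhoR S l hS (p ^ l) f = c • f := by
  have h1 : rhoR S l hS q * rhoR S l hS p = rhoR S l hS p * rhoR S l hS q + 1 := by
    rw [← map_mul, h, map_add, map_mul, map_one]
  obtain ⟨c, hc⟩ := gen_CH (R := RR S l) (M := S[X][X]) hl (RR_l hS)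
    (fun i : ℕ => (X : S[X][X]) ^ i) (RR_span hl.pos) (rhoR S l hS p) (rhoR S l hS q) h1
  exact ⟨c, by rw [map_pow]; exact hc⟩

theorem cent_main (hl : l.Prime) (hS : (l : S) = 0) (p q : Weyl S) (h : q * p = p * q + 1)
    (w : Weyl S) : p ^ l * w = w * p ^ l := by
  obtain ⟨c, hc⟩ := cent_scalar hl hS p q h
  have hc2 : ∀ f, rho S (p ^ l) f = c • f := by
    intro f
    rw [← rhoR_eq hS, hc]
  apply sg_inj
  rw [sg_mul, sg_mul, hc2]
  rw [sg, sg, hc2, ← rhoR_eq hS w, ← rhoR_eq hS w, map_smul]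

theorem cent_coef (hl : l.Prime) (hS : (l : S) = 0) (p q : Weyl S) (h : q * p = p * q + 1)
    (i j : ℕ) (hij : ¬ (l ∣ i ∧ l ∣ j)) : cf (p ^ l) i j = 0 :=
  cent_cf hl hS _ (cent_main hl hS p q h _) (cent_main hl hS p q h _) i j hij

end Central

section Bounds
open Polynomial

variable {S : Type} [CommRing S]

/-- degree bound in both variables -/
def bd (w : Weyl S) (m n : ℕ) : Prop := ∀ i j, m < i ∨ n < j → cf w i j = 0

theorem bd_mono {w : Weyl S} {m n m' n' : ℕ} (h : bd w m n) (hm : m ≤ m') (hn : n ≤ n') :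
    bd w m' n' := fun i j hij => h i j (by omega)

theorem cf_x_mul (w : Weyl S) (i j : ℕ) :
    cf (Wx S * w) i j = if i = 0 then 0 else cf w (i - 1) j := by
  rw [cf, sg_mul, rho_x]
  rcases i with _ | i
  · simp
  · simp [coeff_X_mul, cf]

theorem cf_y_mul (w : Weyl S) (i j : ℕ) :
    cf (Wy S * w) i j = (if j = 0 then 0 else cf w i (j - 1)) + (i + 1 : ℕ) * cf w (i + 1) j := by
  have h := cf_comm_y w i j
  rw [cf_sub, sub_eq_iff_eq_add'] at h
  rw [h]
  congr 1
  have : sg (w * Wy S) = C X * sg w := by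
    rw [← sg_NN (C X * sg w), NN_yr, NN_sg]
  rw [cf, this, coeff_C_mul]
  rcases j with _ | j
  · simp
  · simp [coeff_X_mul, cf]

theorem bd_x_mul {w : Weyl S} {m n : ℕ} (h : bd w m n) : bd (Wx S * w) (m + 1) n := by
  intro i j hij
  rw [cf_x_mul]
  split_ifs with h0
  · rfl
  · exact h _ _ (by omega)

theorem bd_y_mul {w : Weyl S} {m n : ℕ} (h : bd w m n) : bd (Wy S * w) m (n + 1) := by
  intro i j hij
  rw [cf_y_mul, h (i + 1) j (by omega), mul_zero, add_zero]
  split_ifs with h0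
  · rfl
  · exact h _ _ (by omega)

theorem bd_mono_mul {w : Weyl S} {m n : ℕ} (h : bd w m n) (a b : ℕ) :
    bd (Wx S ^ a * Wy S ^ b * w) (m + a) (n + b) := by
  have hy : ∀ b, bd (Wy S ^ b * w) m (n + b) := by
    intro b
    induction b with
    | zero => simpa using h
    | succ b ih => rw [pow_succ', mul_assoc]; exact bd_y_mul ih
  rw [mul_assoc]
  induction a with
  | zero => simpa using hy b
  | succ a ih => rw [pow_succ', mul_assoc]; exact bd_x_mul ih

theorem bd_mul {a b : Weyl S} {m n m' n' : ℕ} (ha : bd a m n) (hb : bd b m' n') :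
    bd (a * b) (m + m') (n + n') := by
  intro i j hij
  rw [w_expand a (m + 1) (n + 1) (fun i j h => ha i j (by omega))]
  simp only [Finset.sum_mul, cf_sum, smul_mul_assoc, cf_smul]
  refine Finset.sum_eq_zero fun s hs => Finset.sum_eq_zero fun t ht => ?_
  have h1 := Finset.mem_range.mp hs
  have h2 := Finset.mem_range.mp ht
  rw [bd_mono_mul hb s t i j (by omega), mul_zero]

theorem bd_pow {a : Weyl S} {m n : ℕ} (ha : bd a m n) (k : ℕ) : bd (a ^ k) (k * m) (k * n) := by
  induction k with
  | zero =>
    intro i j hij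
    have := cf_mono (S := S) 0 0 i j
    rw [pow_zero, pow_zero, mul_one] at this
    rw [pow_zero, this, if_neg (by omega)]
  | succ k ih =>
    rw [pow_succ]
    have := bd_mul ih ha
    rwa [← Nat.succ_mul, ← Nat.succ_mul] at this

theorem rho_lead_y (a : S[X]) (f : S[X][X]) (e : ℕ) (hf : f.natDegree ≤ e) :
    (rho S (aeval (Wy S) a) f).natDegree ≤ e ∧
      (rho S (aeval (Wy S) a) f).coeff e = a * f.coeff e := by
  induction a using Polynomial.induction_on' with
  | add g h hg hh =>
    rw [map_add, map_add, LinearMap.add_apply]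
    refine ⟨(natDegree_add_le _ _).trans (max_le hg.1 hh.1), ?_⟩
    rw [coeff_add, hg.2, hh.2, add_mul]
  | monomial i c =>
    have key : ∀ i, (rho S (Wy S ^ i) f).natDegree ≤ e ∧
        (rho S (Wy S ^ i) f).coeff e = X ^ i * f.coeff e := by
      intro i
      induction i with
      | zero => simpa using hf
      | succ i ih =>
        rw [pow_succ', map_mul, Module.End.mul_apply, rho_y]
        constructor
        · refine (natDegree_add_le _ _).trans (max_le ?_ ?_)
          · exact (natDegree_C_mul_le _ _).trans ih.1
          · exact (natDegree_derivative_le _).trans (by omega)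
        · rw [coeff_add, coeff_C_mul, ih.2, coeff_derivative,
            coeff_eq_zero_of_natDegree_lt (lt_of_le_of_lt ih.1 (Nat.lt_succ_self e))]
          ring
    rw [aeval_monomial, map_mul, Module.End.mul_apply, AlgHom.commutes,
      Module.algebraMap_end_apply]
    refine ⟨(natDegree_smul_le _ _).trans (key i).1, ?_⟩
    rw [coeff_smul, (key i).2, ← C_mul_X_pow_eq_monomial, smul_eq_C_mul, mul_assoc]

theorem rho_lead (w : Weyl S) (f : S[X][X]) (d e : ℕ) (hw : (sg w).natDegree ≤ d)
    (hf : f.natDegree ≤ e) :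
    (rho S w f).natDegree ≤ d + e ∧ (rho S w f).coeff (d + e) = (sg w).coeff d * f.coeff e := by
  have hs : w = ∑ i ∈ Finset.range (d + 1), Wx S ^ i * aeval (Wy S) ((sg w).coeff i) := by
    conv_lhs => rw [← NN_sg w, as_sum_range' (sg w) (d + 1) (by omega), map_sum]
    simp only [NN_monomial]
  have hr : rho S w f = ∑ i ∈ Finset.range (d + 1),
      X ^ i * rho S (aeval (Wy S) ((sg w).coeff i)) f := by
    conv_lhs => rw [hs, map_sum, LinearMap.sum_apply]
    refine Finset.sum_congr rfl fun i _ => ?_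
    rw [map_mul, Module.End.mul_apply, rho_xpow]
  rw [hr]
  constructor
  · refine natDegree_sum_le_of_forall_le _ _ fun i hi => ?_
    have h1 := Finset.mem_range.mp hi
    refine natDegree_mul_le.trans ?_
    have := (rho_lead_y ((sg w).coeff i) f e hf).1
    have := natDegree_X_pow_le (R := S[X]) i
    omega
  · rw [finsetSum_coeff, Finset.sum_eq_single d]
    · rw [add_comm, coeff_X_pow_mul, (rho_lead_y _ f e hf).2]
    · intro i hi hid
      have h1 := Finset.mem_range.mp hi
      have : d + e = (d + e - i) + i := by omega
      rw [this, coeff_X_pow_mul]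
      exact coeff_eq_zero_of_natDegree_lt
        (lt_of_le_of_lt (rho_lead_y _ f e hf).1 (by omega))
    · simp

theorem lead_pow (w : Weyl S) (d n : ℕ) (h1 : ∀ i j, d < i → cf w i j = 0)
    (h2 : ∀ j, n < j → cf w d j = 0) (l : ℕ) : cf (w ^ l) (l * d) (l * n) = cf w d n ^ l := by
  have hw : (sg w).natDegree ≤ d := by
    rw [natDegree_le_iff_coeff_eq_zero]
    intro i hi
    ext j
    exact h1 i j hi
  have key : ∀ l, (sg (w ^ l)).natDegree ≤ l * d ∧
      (sg (w ^ l)).coeff (l * d) = ((sg w).coeff d) ^ l := by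
    intro l
    induction l with
    | zero => simp [sg_one]
    | succ l ih =>
      have := rho_lead w (sg (w ^ l)) d (l * d) hw ih.1
      rw [pow_succ', sg_mul, Nat.succ_mul, add_comm (l * d), pow_succ', ← ih.2]
      exact this
  rw [cf, (key l).2, mul_comm l n, mul_comm n l]
  have hn : ((sg w).coeff d).natDegree ≤ n := by
    rw [natDegree_le_iff_coeff_eq_zero]
    exact h2
  rw [mul_comm]
  first
  | exact coeff_pow_of_natDegree_le hn
  | (rw [mul_comm]; exact coeff_pow_of_natDegree_le hn)

/-- the anti-automorphism `x ↦ x, y ↦ -y` -/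
def wal (S : Type) [CommRing S] : Weyl S →ₐ[S] (Weyl S)ᵐᵒᵖ :=
  wlift (MulOpposite.op (Wx S)) (MulOpposite.op ((-1 : S) • Wy S)) (by
    apply MulOpposite.unop_injective
    simp only [MulOpposite.unop_mul, MulOpposite.unop_add, MulOpposite.unop_op,
      MulOpposite.unop_one]
    have h := wrel (S := S)
    rw [mul_smul_comm, smul_mul_assoc, h, smul_add, add_assoc]
    have h4 : (-1 : S) • (1 : Weyl S) + 1 = 0 := by
      nth_rewrite 2 [← one_smul S (1 : Weyl S)]
      rw [← add_smul, neg_add_cancel, zero_smul]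
    rw [h4, add_zero])

/-- the anti-automorphism as a function -/
def wa (w : Weyl S) : Weyl S := (wal S w).unop

theorem wa_x : wa (Wx S) = Wx S := by rw [wa, wal, wlift_x]; rfl
theorem wa_y : wa (Wy S) = (-1 : S) • Wy S := by rw [wa, wal, wlift_y]; rfl
theorem wa_mul (a b : Weyl S) : wa (a * b) = wa b * wa a := by
  simp only [wa, map_mul, MulOpposite.unop_mul]
theorem wa_add (a b : Weyl S) : wa (a + b) = wa a + wa b := by
  simp only [wa, map_add, MulOpposite.unop_add]
theorem wa_smul (c : S) (b : Weyl S) : wa (c • b) = c • wa b := by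
  simp only [wa, map_smul, MulOpposite.unop_smul]
theorem wa_pow (a : Weyl S) (n : ℕ) : wa (a ^ n) = wa a ^ n := by
  simp only [wa, map_pow, MulOpposite.unop_pow]
theorem wa_alg (r : S) : wa (algebraMap S (Weyl S) r) = algebraMap S (Weyl S) r := by
  rw [wa, AlgHom.commutes]; rfl
theorem wa_zero : wa (0 : Weyl S) = 0 := by
  simp only [wa, map_zero, MulOpposite.unop_zero]
theorem wa_sum {ι : Type*} (s : Finset ι) (g : ι → Weyl S) :
    wa (∑ k ∈ s, g k) = ∑ k ∈ s, wa (g k) := by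
  classical
  induction s using Finset.induction_on with
  | empty => simp [wa_zero]
  | insert a s ha ih => rw [Finset.sum_insert ha, Finset.sum_insert ha, wa_add, ih]

theorem wa_wmap {S' : Type} [CommRing S'] [Algebra S S'] (w : Weyl S) :
    wa (wmap S S' w) = wmap S S' (wa w) := by
  let A : Subalgebra S (Weyl S) :=
    { carrier := {w | wa (wmap S S' w) = wmap S S' (wa w)}
      mul_mem' := by
        intro a b ha hb
        change wa _ = _ at ha hb
        change wa _ = _
        rw [map_mul, wa_mul, wa_mul, map_mul, ha, hb]
      add_mem' := by
        intro a b ha hb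
        change wa _ = _ at ha hb
        change wa _ = _
        rw [map_add, wa_add, wa_add, map_add, ha, hb]
      algebraMap_mem' := by
        intro r
        change wa _ = _
        rw [wa_alg, AlgHom.commutes, walg, wa_alg] }
  refine wsub_top A ?_ ?_ w
  · change wa _ = _
    rw [wmap_x, wa_x, wa_x, wmap_x]
  · change wa _ = _
    rw [wmap_y, wa_y, wa_y, wmap_smul, wmap_y, map_neg, map_one]

end Bounds

section Jac
open Polynomial

variable {S : Type} [CommRing S] {l : ℕ}

theorem jq_cast (l : ℕ) : (l : S ⧸ Ideal.span {(l : S)}) = 0 := by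
  have : algebraMap S (S ⧸ Ideal.span {(l : S)}) (l : S) = 0 := by
    rw [Ideal.Quotient.algebraMap_eq, Ideal.Quotient.eq_zero_iff_mem]
    exact Ideal.mem_span_singleton_self _
  rwa [map_natCast] at this

theorem jq_dvd (r s : S) (h : algebraMap S (S ⧸ Ideal.span {r}) s = 0) : r ∣ s := by
  rwa [Ideal.Quotient.algebraMap_eq, Ideal.Quotient.eq_zero_iff_mem,
    Ideal.mem_span_singleton] at h

theorem pow_coef_dvd (hl : l.Prime) (p q : Weyl S) (h : q * p = p * q + 1)
    (i j : ℕ) (hij : ¬ (l ∣ i ∧ l ∣ j)) : (l : S) ∣ cf (p ^ l) i j := by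
  apply jq_dvd
  rw [← cf_wmap, map_pow]
  refine cent_coef hl (jq_cast l) _ (wmap S _ q) ?_ i j hij
  rw [← map_mul, h, map_add, map_mul, map_one]

theorem swap_rel (p q : Weyl S) (h : q * p = p * q + 1) :
    p * ((-1 : S) • q) = ((-1 : S) • q) * p + 1 := by
  rw [mul_smul_comm, smul_mul_assoc, h, smul_add, add_assoc]
  have h4 : (-1 : S) • (1 : Weyl S) + 1 = 0 := by
    nth_rewrite 2 [← one_smul S (1 : Weyl S)]
    rw [← add_smul, neg_add_cancel, zero_smul]
  rw [h4, add_zero]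

theorem neg_pow_cf (q : Weyl S) (n i j : ℕ) :
    cf (((-1 : S) • q) ^ n) i j = (-1) ^ n * cf (q ^ n) i j := by
  rw [_root_.smul_pow, cf_smul]

theorem pow_coef_dvd2 (hl : l.Prime) (p q : Weyl S) (h : q * p = p * q + 1)
    (i j : ℕ) (hij : ¬ (l ∣ i ∧ l ∣ j)) : (l : S) ∣ cf (q ^ l) i j := by
  have := pow_coef_dvd hl _ _ (swap_rel p q h) i j hij
  rw [neg_pow_cf] at this
  have h2 := this.mul_left ((-1) ^ l)
  rwa [← mul_assoc, ← mul_pow, neg_one_mul, neg_neg, one_pow, one_mul] at h2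

theorem odd_aux (hl : l.Prime) (hS : (l : S) = 0) (h2 : l ≠ 2) (Q : Weyl S)
    (hQ : ∀ i j, ¬ (l ∣ i ∧ l ∣ j) → cf Q i j = 0) (hs : wa Q = (-1 : S) • Q) (i : ℕ) :
    cf Q (l * i) 0 = 0 := by
  obtain ⟨D, hD⟩ := cf_bound Q
  have e := w_expand Q D D hD
  have e2 : wa Q = ∑ i ∈ Finset.range D, ∑ j ∈ Finset.range D,
      (cf Q i j * (-1) ^ j) • (Wx S ^ i * Wy S ^ j) := by
    conv_lhs => rw [e]
    simp only [wa_sum, wa_smul, wa_mul, wa_pow, wa_x, wa_y, _root_.smul_pow]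
    refine Finset.sum_congr rfl fun a _ => Finset.sum_congr rfl fun b _ => ?_
    by_cases hab : l ∣ a ∧ l ∣ b
    · obtain ⟨⟨c, rfl⟩, -⟩ := hab
      have : Commute (Wy S ^ b) (Wx S ^ (l * c)) := by
        rw [pow_mul]
        apply Commute.pow_right
        exact (cent_main hl hS (Wx S) (Wy S) wrel (Wy S ^ b)).symm
      rw [smul_mul_assoc, this.eq, smul_smul]
    · rw [hQ a b hab]; simp
  have e3 : cf (wa Q) (l * i) 0 = cf Q (l * i) 0 := by
    rw [e2]
    conv_rhs => rw [e]
    simp only [cf_sum, cf_smul, cf_mono]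
    refine Finset.sum_congr rfl fun a _ => Finset.sum_congr rfl fun b _ => ?_
    by_cases hb : b = 0
    · subst hb; simp
    · rw [if_neg (by omega)]; simp
  rw [hs, cf_smul] at e3
  have h3 : ((2 : ℕ) : S) * cf Q (l * i) 0 = 0 := by
    push_cast
    linear_combination -e3
  refine ((isUnit_of_not_dvd hl hS ?_).mul_right_eq_zero).1 h3
  intro hd
  exact h2 ((Nat.prime_dvd_prime_iff_eq hl Nat.prime_two).1 hd)

theorem odd_dvd (hl : l.Prime) (h2 : l ≠ 2) (p q : Weyl S) (h : q * p = p * q + 1)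
    (hs : wa q = (-1 : S) • q) (i : ℕ) : (l : S) ∣ cf (q ^ l) (l * i) 0 := by
  apply jq_dvd
  rw [← cf_wmap]
  refine odd_aux hl (jq_cast l) h2 _ ?_ ?_ i
  · intro i j hij
    rw [cf_wmap, Ideal.Quotient.algebraMap_eq, Ideal.Quotient.eq_zero_iff_mem,
      Ideal.mem_span_singleton]
    exact pow_coef_dvd2 hl p q h i j hij
  · rw [wa_wmap, wa_pow, hs, _root_.smul_pow, (hl.odd_of_ne_two h2).neg_one_pow, wmap_smul, map_neg,
      map_one]

theorem exists_div (w : Weyl S) (r : S) (h : ∀ i j, r ∣ cf w i j) : ∃ E : Weyl S, w = r • E := by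
  choose e he using h
  obtain ⟨D, hD⟩ := cf_bound w
  refine ⟨∑ i ∈ Finset.range D, ∑ j ∈ Finset.range D, e i j • (Wx S ^ i * Wy S ^ j), ?_⟩
  conv_lhs => rw [w_expand w D D hD]
  simp only [Finset.smul_sum, smul_smul, ← he]

theorem decomp (hl : l.Prime) (w : Weyl S) (D : ℕ) (hb : bd w (l * D) (l * D))
    (hw : ∀ i j, ¬ (l ∣ i ∧ l ∣ j) → (l : S) ∣ cf w i j) :
    ∃ E : Weyl S, w = ∑ i ∈ Finset.range (D + 1), ∑ j ∈ Finset.range (D + 1),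
      cf w (l * i) (l * j) • ((Wx S ^ l) ^ i * (Wy S ^ l) ^ j) + (l : S) • E := by
  set Z := ∑ i ∈ Finset.range (D + 1), ∑ j ∈ Finset.range (D + 1),
      cf w (l * i) (l * j) • ((Wx S ^ l) ^ i * (Wy S ^ l) ^ j) with hZ
  have hl0 := hl.pos
  obtain ⟨E, hE⟩ := exists_div (w - Z) (l : S) (by
    intro a b
    rw [cf_sub]
    simp only [hZ, cf_sum, cf_smul, ← pow_mul, cf_mono]
    by_cases hab : l ∣ a ∧ l ∣ b
    · obtain ⟨⟨a, rfl⟩, ⟨b, rfl⟩⟩ := hab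
      simp only [mul_eq_mul_left_iff, hl0.ne', or_false]
      convert dvd_zero _
      rw [sub_eq_zero]
      by_cases hab : a < D + 1 ∧ b < D + 1
      · rw [Finset.sum_eq_single a, Finset.sum_eq_single b]
        · simp
        · intro c _ hc; simp [hc]
        · intro hc; simp [hab.2] at hc
        · intro c _ hc; simp [hc]
        · intro hc; simp [hab.1] at hc
      · rw [hb, Finset.sum_eq_zero]
        · intro i hi
          refine Finset.sum_eq_zero fun j hj => ?_
          have h1 := Finset.mem_range.mp hi
          have h2 := Finset.mem_range.mp hj
          rw [if_neg (by rintro ⟨rfl, rfl⟩; exact hab ⟨h1, h2⟩), mul_zero]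
        · have : D < a ∨ D < b := by omega
          exact this.imp (fun h => Nat.mul_lt_mul_of_pos_left h hl0)
            (fun h => Nat.mul_lt_mul_of_pos_left h hl0)
    · rw [Finset.sum_eq_zero, sub_zero]
      · exact hw a b hab
      · intro i _
        refine Finset.sum_eq_zero fun j _ => ?_
        rw [if_neg (by rintro ⟨rfl, rfl⟩; exact hab ⟨⟨_, rfl⟩, ⟨_, rfl⟩⟩), mul_zero])
  exact ⟨E, by rw [← hE]; abel⟩

theorem jac_pow {R : Type*} [Ring R] (x y N : R) (hNc : ∀ w, w * N = N * w)
    (hNy : ∀ w, N * (y * w) = N * (w * y)) (h : y * x = x * y + N) (m i : ℕ) :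
    y ^ m * x ^ i = x ^ i * y ^ m + N * ((m * i : ℕ) : R) * (x ^ (i - 1) * y ^ (m - 1)) := by
  have h1 : ∀ i : ℕ, y * x ^ i = x ^ i * y + N * (i : R) * x ^ (i - 1) := by
    intro i
    induction i with
    | zero => simp
    | succ i ih =>
      rw [pow_succ, ← mul_assoc, ih, add_mul, mul_assoc, h, mul_add, hNc]
      rcases i with _ | i
      · simp
      · simp only [Nat.add_sub_cancel, pow_succ, Nat.cast_add, Nat.cast_one, mul_assoc, mul_add,
          add_mul, one_mul, mul_one]
        abel
  induction m with
  | zero => simp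
  | succ m ih =>
    rw [pow_succ', mul_assoc, ih, mul_add, ← mul_assoc y (x ^ i), h1, add_mul]
    have h2 : y * (N * ((m * i : ℕ) : R) * (x ^ (i - 1) * y ^ (m - 1))) =
        N * ((m * i : ℕ) : R) * (x ^ (i - 1) * y ^ m) := by
      rcases m with _ | m
      · simp
      · rw [mul_assoc N, ← mul_assoc y, hNc y, mul_assoc N, hNy, Nat.add_sub_cancel, pow_succ]
        simp only [mul_assoc]
    rw [h2, Nat.add_sub_cancel, mul_assoc (x ^ i), ← pow_succ', mul_assoc (N * (i : R)), add_assoc,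
      ← add_mul, ← mul_add, ← Nat.cast_add]
    congr 5
    ring

theorem jac_mono {R : Type*} [Ring R] (x y N : R) (hNc : ∀ w, w * N = N * w)
    (hNy : ∀ w, N * (y * w) = N * (w * y)) (h : y * x = x * y + N) (i j k m : ℕ) :
    x ^ k * y ^ m * (x ^ i * y ^ j) - x ^ i * y ^ j * (x ^ k * y ^ m) =
      N * (((m * i : ℕ) : R) - ((j * k : ℕ) : R)) * (x ^ (i + k - 1) * y ^ (j + m - 1)) := by
  have key : ∀ i j k m : ℕ, x ^ k * y ^ m * (x ^ i * y ^ j) = x ^ (k + i) * y ^ (m + j) +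
      N * ((m * i : ℕ) : R) * (x ^ (i + k - 1) * y ^ (j + m - 1)) := by
    intro i j k m
    have := jac_pow x y N hNc hNy h m i
    calc _ = x ^ k * (y ^ m * x ^ i) * y ^ j := by simp only [mul_assoc]
      _ = x ^ (k + i) * y ^ (m + j) +
          x ^ k * (N * ((m * i : ℕ) : R)) * (x ^ (i - 1) * y ^ (m - 1)) * y ^ j := by
        rw [this, pow_add, pow_add]; simp only [mul_add, add_mul, mul_assoc]
      _ = _ := by
        congr 1
        rw [← mul_assoc (x ^ k), hNc, mul_assoc N, ← Nat.cast_comm]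
        by_cases h0 : m * i = 0
        · simp [h0]
        · have hm : m ≠ 0 := by rintro rfl; simp at h0
          have hi : i ≠ 0 := by rintro rfl; simp at h0
          have e1 : i + k - 1 = k + (i - 1) := by omega
          have e2 : j + m - 1 = (m - 1) + j := by omega
          rw [e1, e2, pow_add, pow_add]
          simp only [mul_assoc]
  rw [key i j k m, key k m i j, mul_sub, sub_mul, add_comm k i, add_comm m j]
  abel

end Jac

section Jac2
open Polynomial

variable {S : Type} [CommRing S] {l : ℕ}

theorem comm_div (hl : l.Prime) (p q : Weyl S) (h : q * p = p * q + 1) (w : Weyl S) :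
    ∃ E : Weyl S, p ^ l * w - w * p ^ l = (l : S) • E := by
  apply exists_div
  intro i j
  apply jq_dvd
  rw [← cf_wmap, map_sub, map_mul, map_mul, map_pow,
    cent_main hl (jq_cast l) _ (wmap S _ q) (by rw [← map_mul, h, map_add, map_mul, map_one]),
    sub_self, cf_zero]

theorem lc_of (hl : l.Prime) (hS : (l : S) * l = 0) (p q : Weyl S) (h : q * p = p * q + 1)
    (w : Weyl S) : (l : S) • (p ^ l * w) = (l : S) • (w * p ^ l) := by
  obtain ⟨E, hE⟩ := comm_div hl p q h w
  rw [sub_eq_iff_eq_add] at hE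
  rw [hE, smul_add, smul_smul, hS, zero_smul, zero_add]

theorem lc_of2 (hl : l.Prime) (hS : (l : S) * l = 0) (p q : Weyl S) (h : q * p = p * q + 1)
    (w : Weyl S) : (l : S) • (q ^ l * w) = (l : S) • (w * q ^ l) := by
  have h2 := lc_of hl hS _ _ (swap_rel p q h) w
  rw [_root_.smul_pow, smul_mul_assoc, mul_smul_comm] at h2
  have h3 := congrArg (fun z => ((-1 : S) ^ l) • z) h2
  simp only [smul_smul] at h3
  have e : (-1 : S) ^ l * (l * (-1) ^ l) = l := by
    rw [mul_comm, mul_assoc, ← mul_pow, neg_one_mul, neg_neg, one_pow, mul_one]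
  rwa [e] at h3

/-- elements central up to multiplication by `l` -/
def lcA (S : Type) [CommRing S] (l : ℕ) : Subalgebra S (Weyl S) where
  carrier := {z | ∀ w, (l : S) • (z * w) = (l : S) • (w * z)}
  mul_mem' := by
    intro a b ha hb w
    rw [mul_assoc, ha, mul_assoc, hb, mul_assoc]
  add_mem' := by
    intro a b ha hb w
    rw [add_mul, mul_add, smul_add, smul_add, ha, hb]
  algebraMap_mem' := by
    intro r w
    rw [Algebra.commutes]

theorem jac_Z (hS : (l : S) * l = 0) (P Q ZP ZQ E E' N : Weyl S)
    (hP : P = ZP + (l : S) • E) (hQ : Q = ZQ + (l : S) • E') (hZP : ZP ∈ lcA S l)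
    (hZQ : ZQ ∈ lcA S l) (h : Q * P = P * Q + N) : ZQ * ZP - ZP * ZQ = N := by
  have e1 : Q * P = ZQ * ZP + ((l : S) • (ZQ * E) + (l : S) • (E' * ZP)) := by
    rw [hP, hQ, add_mul, mul_add, mul_add, mul_smul_comm, smul_mul_assoc, smul_mul_assoc,
      mul_smul_comm, smul_smul, hS, zero_smul, add_zero, add_assoc]
  have e2 : P * Q = ZP * ZQ + ((l : S) • (ZP * E') + (l : S) • (E * ZQ)) := by
    rw [hP, hQ, add_mul, mul_add, mul_add, mul_smul_comm, smul_mul_assoc, smul_mul_assoc,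
      mul_smul_comm, smul_smul, hS, zero_smul, add_zero, add_assoc]
  rw [e1, e2, hZP E', hZQ E, add_comm ((l : S) • (E' * ZP))] at h
  rw [sub_eq_iff_eq_add]
  have h3 : ZQ * ZP + ((l : S) • (E * ZQ) + (l : S) • (E' * ZP)) =
      (N + ZP * ZQ) + ((l : S) • (E * ZQ) + (l : S) • (E' * ZP)) := by
    rw [h]; abel
  exact add_right_cancel h3

theorem jac_sum (hl : l.Prime) (hS : (l : S) * l = 0) (D : ℕ) (F G : ℕ → ℕ → S)
    (P Q E E' : Weyl S)
    (hP : P = ∑ i ∈ Finset.range (D + 1), ∑ j ∈ Finset.range (D + 1),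
      F i j • ((Wx S ^ l) ^ i * (Wy S ^ l) ^ j) + (l : S) • E)
    (hQ : Q = ∑ i ∈ Finset.range (D + 1), ∑ j ∈ Finset.range (D + 1),
      G i j • ((Wx S ^ l) ^ i * (Wy S ^ l) ^ j) + (l : S) • E')
    (h : Q * P = P * Q + (l.factorial : Weyl S)) (a b : ℕ) :
    (l.factorial : S) * (if 0 = a ∧ 0 = b then 1 else 0) =
      ∑ k ∈ Finset.range (D + 1), ∑ m ∈ Finset.range (D + 1),
      ∑ i ∈ Finset.range (D + 1), ∑ j ∈ Finset.range (D + 1),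
      (G k m * F i j * (l.factorial * (((m * i : ℕ) : S) - ((j * k : ℕ) : S)))) *
        (if i + k - 1 = a ∧ j + m - 1 = b then 1 else 0) := by
  set x := Wx S ^ l with hx
  set y := Wy S ^ l with hy
  have hxA : x ∈ lcA S l := fun w => lc_of hl hS _ _ wrel w
  have hyA : y ∈ lcA S l := fun w => lc_of2 hl hS _ _ wrel w
  have hm : ∀ i j, x ^ i * y ^ j ∈ lcA S l := fun i j =>
    mul_mem (pow_mem hxA i) (pow_mem hyA j)
  have hZ : ∀ F : ℕ → ℕ → S, ∑ i ∈ Finset.range (D + 1), ∑ j ∈ Finset.range (D + 1),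
      F i j • (x ^ i * y ^ j) ∈ lcA S l := fun F =>
    sum_mem fun i _ => sum_mem fun j _ => Subalgebra.smul_mem _ (hm i j) _
  have hZZ := jac_Z hS P Q _ _ E E' _ hP hQ (hZ F) (hZ G) h
  have hl2 : ∀ r : Weyl S, (l : Weyl S) ^ 2 * r = 0 := by
    intro r
    have : (l : Weyl S) ^ 2 = algebraMap S (Weyl S) ((l : S) * l) := by
      rw [map_mul, map_natCast, sq]
    rw [this, hS, map_zero, zero_mul]
  have hyx : y * x = x * y + (l.factorial : Weyl S) := by
    obtain ⟨r, hr⟩ := wcomm_prime (wrel (S := S)) hl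
    rw [hl2, add_zero, sub_eq_iff_eq_add'] at hr
    exact hr
  have hN : (l.factorial : Weyl S) = algebraMap S (Weyl S) l.factorial := (map_natCast _ _).symm
  have hfac : (l.factorial : S) = (l - 1).factorial * l := by
    rw [← Nat.mul_factorial_pred hl.ne_zero, Nat.cast_mul, mul_comm]
  have hNy : ∀ w, (l.factorial : Weyl S) * (y * w) = (l.factorial : Weyl S) * (w * y) := by
    intro w
    rw [hN, ← Algebra.smul_def, ← Algebra.smul_def, hfac, mul_smul, mul_smul, hyA w]
  have hc : ∀ w : Weyl S, w * (l.factorial : Weyl S) = (l.factorial : Weyl S) * w :=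
    fun w => (Nat.cast_comm _ _).symm
  have key : ∀ i j k m, x ^ k * y ^ m * (x ^ i * y ^ j) - x ^ i * y ^ j * (x ^ k * y ^ m) =
      (l.factorial * (((m * i : ℕ) : S) - ((j * k : ℕ) : S))) •
        (x ^ (i + k - 1) * y ^ (j + m - 1)) := by
    intro i j k m
    rw [jac_mono x y _ hc hNy hyx, Algebra.smul_def, map_mul, map_sub, map_natCast, map_natCast,
      map_natCast]
  have hone : cf (l.factorial : Weyl S) (l * a) (l * b) =
      (l.factorial : S) * (if 0 = a ∧ 0 = b then 1 else 0) := by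
    have := cf_mono (S := S) 0 0 (l * a) (l * b)
    rw [pow_zero, pow_zero, mul_one] at this
    rw [hN, Algebra.algebraMap_eq_smul_one, cf_smul, this]
    have e : (0 = l * a ∧ 0 = l * b) ↔ (0 = a ∧ 0 = b) := by
      simp [hl.ne_zero, eq_comm]
    simp only [e]
  have hcm : ∀ i j, cf (x ^ i * y ^ j) (l * a) (l * b) = if i = a ∧ j = b then 1 else 0 := by
    intro i j
    rw [hx, hy, ← pow_mul, ← pow_mul, cf_mono]
    simp only [mul_eq_mul_left_iff, hl.ne_zero, or_false]
  rw [← hone, ← hZZ]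
  have hexp : (∑ i ∈ Finset.range (D + 1), ∑ j ∈ Finset.range (D + 1), G i j • (x ^ i * y ^ j)) *
      (∑ i ∈ Finset.range (D + 1), ∑ j ∈ Finset.range (D + 1), F i j • (x ^ i * y ^ j)) -
      (∑ i ∈ Finset.range (D + 1), ∑ j ∈ Finset.range (D + 1), F i j • (x ^ i * y ^ j)) *
      (∑ i ∈ Finset.range (D + 1), ∑ j ∈ Finset.range (D + 1), G i j • (x ^ i * y ^ j)) =
      ∑ k ∈ Finset.range (D + 1), ∑ m ∈ Finset.range (D + 1),
      ∑ i ∈ Finset.range (D + 1), ∑ j ∈ Finset.range (D + 1),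
      (G k m * F i j * (l.factorial * (((m * i : ℕ) : S) - ((j * k : ℕ) : S)))) •
        (x ^ (i + k - 1) * y ^ (j + m - 1)) := by
    rw [Finset.sum_mul, Finset.mul_sum, ← Finset.sum_sub_distrib]
    refine Finset.sum_congr rfl fun k _ => ?_
    rw [Finset.sum_mul, Finset.mul_sum, ← Finset.sum_sub_distrib]
    refine Finset.sum_congr rfl fun m _ => ?_
    rw [Finset.sum_mul, Finset.mul_sum, ← Finset.sum_sub_distrib]
    refine Finset.sum_congr rfl fun i _ => ?_
    rw [Finset.sum_mul, Finset.mul_sum, ← Finset.sum_sub_distrib]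
    refine Finset.sum_congr rfl fun j _ => ?_
    rw [mul_smul, ← key, smul_mul_assoc, mul_smul_comm, smul_mul_assoc, mul_smul_comm, smul_smul,
      smul_smul, mul_comm (F i j), Algebra.smul_def, Algebra.smul_def, Algebra.smul_def, mul_sub]
  rw [hexp]
  simp only [cf_sum, cf_smul, hcm]

theorem jac_final (hl : l.Prime) (hreg : ∀ s : S, (l : S) * s = 0 → s = 0)
    (p q : Weyl S) (h : q * p = p * q + 1) (D : ℕ) (hp : bd p D D) (hq : bd q D D)
    {k : Type} [Field k] [Algebra S k] (hk : (l : k) = 0) (a b : ℕ) :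
    (if 1 = a ∧ 1 = b then 1 else 0 : k) =
      ∑ s ∈ Finset.range (D + 1), ∑ m ∈ Finset.range (D + 1),
      ∑ i ∈ Finset.range (D + 1), ∑ j ∈ Finset.range (D + 1),
      (algebraMap S k (cf (q ^ l) (l * s) (l * m)) * algebraMap S k (cf (p ^ l) (l * i) (l * j)) *
        (((m * i : ℕ) : k) - ((j * s : ℕ) : k))) *
        (if i + s = a ∧ j + m = b then 1 else 0) := by
  by_cases hab : a = 0 ∨ b = 0
  · rw [if_neg (by omega)]
    symm
    refine Finset.sum_eq_zero fun s _ => Finset.sum_eq_zero fun m _ => Finset.sum_eq_zero fun i _ =>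
      Finset.sum_eq_zero fun j _ => ?_
    by_cases hc : i + s = a ∧ j + m = b
    · have : m * i = 0 ∧ j * s = 0 := by
        rcases hab with h0 | h0
        · have h1 : i = 0 := by omega
          have h2 : s = 0 := by omega
          simp [h1, h2]
        · have h1 : j = 0 := by omega
          have h2 : m = 0 := by omega
          simp [h1, h2]
      rw [this.1, this.2]; simp
    · rw [if_neg hc, mul_zero]
  obtain ⟨a, rfl⟩ : ∃ a', a = a' + 1 := ⟨a - 1, by omega⟩
  obtain ⟨b, rfl⟩ : ∃ b', b = b' + 1 := ⟨b - 1, by omega⟩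
  obtain ⟨E, hE⟩ := decomp hl (p ^ l) D (bd_pow hp l) (pow_coef_dvd hl p q h)
  obtain ⟨E', hE'⟩ := decomp hl (q ^ l) D (bd_pow hq l) (pow_coef_dvd2 hl p q h)
  set F : ℕ → ℕ → S := fun i j => cf (p ^ l) (l * i) (l * j) with hF
  set G : ℕ → ℕ → S := fun i j => cf (q ^ l) (l * i) (l * j) with hG
  let S2 := S ⧸ Ideal.span {(l : S) * l}
  have hS2 : (l : S2) * l = 0 := by
    have : algebraMap S S2 ((l : S) * l) = 0 := by
      rw [Ideal.Quotient.algebraMap_eq, Ideal.Quotient.eq_zero_iff_mem]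
      exact Ideal.mem_span_singleton_self _
    rwa [map_mul, map_natCast] at this
  have hmap : ∀ (F : ℕ → ℕ → S) (w E : Weyl S),
      w = ∑ i ∈ Finset.range (D + 1), ∑ j ∈ Finset.range (D + 1),
        F i j • ((Wx S ^ l) ^ i * (Wy S ^ l) ^ j) + (l : S) • E →
      wmap S S2 w = ∑ i ∈ Finset.range (D + 1), ∑ j ∈ Finset.range (D + 1),
        algebraMap S S2 (F i j) • ((Wx S2 ^ l) ^ i * (Wy S2 ^ l) ^ j) +
          (l : S2) • wmap S S2 E := by
    intro F w E hw
    rw [hw, map_add, map_sum, wmap_smul, map_natCast]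
    simp only [map_sum, wmap_smul, map_mul, map_pow, wmap_x, wmap_y]
  have hcomm : wmap S S2 (q ^ l) * wmap S S2 (p ^ l) =
      wmap S S2 (p ^ l) * wmap S S2 (q ^ l) + (l.factorial : Weyl S2) := by
    obtain ⟨r, hr⟩ := wcomm_prime h hl
    rw [sub_eq_iff_eq_add'] at hr
    rw [← map_mul, hr, map_add, map_add, map_mul, map_natCast, map_mul,
      map_pow _ (l : Weyl S), map_natCast]
    have : (l : Weyl S2) ^ 2 = algebraMap S2 (Weyl S2) ((l : S2) * l) := by
      rw [map_mul, map_natCast, sq]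
    rw [this, hS2, map_zero, zero_mul, add_zero]
  have hj := jac_sum hl hS2 D (fun i j => algebraMap S S2 (F i j)) (fun i j => algebraMap S S2 (G i j))
    _ _ _ _ (hmap F _ E hE) (hmap G _ E' hE') hcomm a b
  set SS : S := ∑ s ∈ Finset.range (D + 1), ∑ m ∈ Finset.range (D + 1),
      ∑ i ∈ Finset.range (D + 1), ∑ j ∈ Finset.range (D + 1),
      (G s m * F i j * (((m * i : ℕ) : S) - ((j * s : ℕ) : S))) *
        (if i + s = a + 1 ∧ j + m = b + 1 then 1 else 0) with hSS
  have hj2 : algebraMap S S2 ((l.factorial : S) * (SS - if 0 = a ∧ 0 = b then 1 else 0)) = 0 := by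
    rw [mul_sub, map_sub, sub_eq_zero]
    symm
    have e : algebraMap S S2 ((l.factorial : S) * if 0 = a ∧ 0 = b then 1 else 0) =
        (l.factorial : S2) * if 0 = a ∧ 0 = b then 1 else 0 := by
      rw [map_mul, map_natCast, apply_ite (algebraMap S S2), map_one, map_zero]
    rw [e, hj, hSS]
    simp only [Finset.mul_sum, map_sum]
    refine Finset.sum_congr rfl fun s _ => Finset.sum_congr rfl fun m _ =>
      Finset.sum_congr rfl fun i _ => Finset.sum_congr rfl fun j _ => ?_
    simp only [map_mul, map_sub, map_natCast, apply_ite (algebraMap S S2), map_one, map_zero]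
    by_cases hms : m * i = 0 ∧ j * s = 0
    · rw [hms.1, hms.2]; simp
    · have : (i + s - 1 = a ∧ j + m - 1 = b) ↔ (i + s = a + 1 ∧ j + m = b + 1) := by
        have h1 : i + s ≠ 0 := by
          intro h0
          have h1 : i = 0 := by omega
          have h2 : s = 0 := by omega
          exact hms (by simp [h1, h2])
        have h2 : j + m ≠ 0 := by
          intro h0
          have h1 : j = 0 := by omega
          have h2 : m = 0 := by omega
          exact hms (by simp [h1, h2])
        omega
      simp only [this]
      ring
  obtain ⟨r, hr⟩ := jq_dvd _ _ hj2
  have hfac : (l.factorial : S) = l * (l - 1).factorial := by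
    rw [← Nat.mul_factorial_pred hl.ne_zero, Nat.cast_mul]
  have hr2 : ((l - 1).factorial : S) * (SS - if 0 = a ∧ 0 = b then 1 else 0) = l * r := by
    rw [← sub_eq_zero]
    apply hreg
    rw [hfac] at hr
    linear_combination hr
  have hr3 := congrArg (algebraMap S k) hr2
  rw [map_mul, map_mul, map_natCast, map_natCast, hk, zero_mul, mul_eq_zero] at hr3
  have hu : ((l - 1).factorial : k) ≠ 0 := by
    apply IsUnit.ne_zero
    apply isUnit_of_not_dvd hl hk
    rw [hl.dvd_factorial]
    have := hl.pos
    omega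
  have hr4 := hr3.resolve_left hu
  rw [map_sub, sub_eq_zero, apply_ite (algebraMap S k), map_one, map_zero, hSS] at hr4
  have e : (1 = a + 1 ∧ 1 = b + 1) ↔ (0 = a ∧ 0 = b) := by omega
  simp only [e]
  rw [← hr4]
  simp only [map_sum, map_mul, map_sub, map_natCast, apply_ite (algebraMap S k), map_one, map_zero]
  rfl

end Jac2

section Comb

theorem comb_lemma {k : Type} [Field k] (D : ℕ) (F G : ℕ → ℕ → k)
    (hF : ∀ i j, F i j ≠ 0 → i ≤ D ∧ j ≤ D) (hG : ∀ i j, G i j ≠ 0 → i ≤ D ∧ j ≤ D)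
    (hc : ∀ a b : ℕ, a ≤ D * D → b ≤ D * D → (a : k) = (b : k) → a = b)
    (H : ∀ a b : ℕ, (if 1 = a ∧ 1 = b then 1 else 0 : k) =
      ∑ s ∈ Finset.range (D + 1), ∑ m ∈ Finset.range (D + 1),
      ∑ i ∈ Finset.range (D + 1), ∑ j ∈ Finset.range (D + 1),
      (G s m * F i j * (((m * i : ℕ) : k) - ((j * s : ℕ) : k))) *
        (if i + s = a ∧ j + m = b then 1 else 0))
    (hG0 : ∀ i, G i 0 = 0) (s m : ℕ) (hsm : G s m ≠ 0) : s = 0 ∧ m = 1 := by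
  classical
  have uniq : ∀ i0 j0 s0 m0, F i0 j0 ≠ 0 → G s0 m0 ≠ 0 →
      (∀ i j s m, F i j ≠ 0 → G s m ≠ 0 → i + s = i0 + s0 → j + m = j0 + m0 →
        i = i0 ∧ j = j0 ∧ s = s0 ∧ m = m0) →
      m0 * i0 = j0 * s0 ∨ (i0 + s0 = 1 ∧ j0 + m0 = 1) := by
    intro i0 j0 s0 m0 hf hg hu
    by_cases h11 : i0 + s0 = 1 ∧ j0 + m0 = 1
    · exact Or.inr h11
    left
    have h := H (i0 + s0) (j0 + m0)
    rw [if_neg (by omega)] at h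
    have hfb := hF _ _ hf
    have hgb := hG _ _ hg
    have term : ∀ s m i j, ¬ (i = i0 ∧ j = j0 ∧ s = s0 ∧ m = m0) →
        (G s m * F i j * (((m * i : ℕ) : k) - ((j * s : ℕ) : k))) *
          (if i + s = i0 + s0 ∧ j + m = j0 + m0 then 1 else 0) = 0 := by
      intro s m i j hne
      by_cases h1 : G s m = 0
      · simp [h1]
      by_cases h2 : F i j = 0
      · simp [h2]
      rw [if_neg (fun h3 => hne (hu i j s m h2 h1 h3.1 h3.2)), mul_zero]
    rw [Finset.sum_eq_single s0, Finset.sum_eq_single m0, Finset.sum_eq_single i0,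
      Finset.sum_eq_single j0] at h
    · rw [if_pos ⟨rfl, rfl⟩, mul_one] at h
      have h3 := (mul_eq_zero.1 h.symm).resolve_left (mul_ne_zero hg hf)
      rw [sub_eq_zero] at h3
      exact hc _ _ (Nat.mul_le_mul hgb.2 hfb.1) (Nat.mul_le_mul hfb.2 hgb.1) h3
    · intro j _ hj
      exact term _ _ _ _ (by tauto)
    · intro hj
      exact absurd (Finset.mem_range.2 (by omega)) hj
    · intro i _ hi
      exact Finset.sum_eq_zero fun j _ => term _ _ _ _ (by tauto)
    · intro hj
      exact absurd (Finset.mem_range.2 (by omega)) hj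
    · intro m _ hi
      exact Finset.sum_eq_zero fun i _ => Finset.sum_eq_zero fun j _ => term _ _ _ _ (by tauto)
    · intro hj
      exact absurd (Finset.mem_range.2 (by omega)) hj
    · intro s _ hi
      exact Finset.sum_eq_zero fun m _ => Finset.sum_eq_zero fun i _ =>
        Finset.sum_eq_zero fun j _ => term _ _ _ _ (by tauto)
    · intro hj
      exact absurd (Finset.mem_range.2 (by omega)) hj
  have hGpos : ∀ s m, G s m ≠ 0 → 1 ≤ m := by
    intro s m h
    rcases m with _ | m
    · exact absurd (hG0 s) h
    · omega
  have base : F 1 0 ≠ 0 ∧ G 0 1 ≠ 0 := by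
    have h := H 1 1
    rw [if_pos ⟨rfl, rfl⟩] at h
    have h1 : (1 : k) ≠ 0 := one_ne_zero
    rw [h] at h1
    obtain ⟨s, -, h1⟩ := Finset.exists_ne_zero_of_sum_ne_zero h1
    obtain ⟨m, -, h1⟩ := Finset.exists_ne_zero_of_sum_ne_zero h1
    obtain ⟨i, -, h1⟩ := Finset.exists_ne_zero_of_sum_ne_zero h1
    obtain ⟨j, -, h1⟩ := Finset.exists_ne_zero_of_sum_ne_zero h1
    have h2 := left_ne_zero_of_mul h1
    have h3 := right_ne_zero_of_mul h1
    have h4 : i + s = 1 ∧ j + m = 1 := by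
      by_contra h4
      exact h3 (if_neg h4)
    have h5 := right_ne_zero_of_mul h2
    have h6 := left_ne_zero_of_mul (left_ne_zero_of_mul h2)
    have h7 := right_ne_zero_of_mul (left_ne_zero_of_mul h2)
    have h8 := hGpos _ _ h6
    have hm : m = 1 := by omega
    have hj : j = 0 := by omega
    subst hm hj
    have hi : i ≠ 0 := by
      rintro rfl
      simp at h5
    have hi1 : i = 1 := by omega
    have hs0 : s = 0 := by omega
    subst hi1 hs0
    exact ⟨h7, h6⟩
  have part1 : (∀ i, F i 0 ≠ 0 → i ≤ 1) ∧ (∀ s, G s 1 ≠ 0 → s = 0) := by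
    let A := (Finset.range (D + 1)).filter (fun i => F i 0 ≠ 0)
    let B := (Finset.range (D + 1)).filter (fun s => G s 1 ≠ 0)
    have hA : ∀ i, F i 0 ≠ 0 → i ∈ A := fun i hi =>
      Finset.mem_filter.2 ⟨Finset.mem_range.2 (by have := (hF _ _ hi).1; omega), hi⟩
    have hB : ∀ i, G i 1 ≠ 0 → i ∈ B := fun i hi =>
      Finset.mem_filter.2 ⟨Finset.mem_range.2 (by have := (hG _ _ hi).1; omega), hi⟩
    obtain ⟨i0, hi0, hmaxi⟩ := Finset.exists_max_image A id ⟨1, hA 1 base.1⟩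
    obtain ⟨s0, hs0, hmaxs⟩ := Finset.exists_max_image B id ⟨0, hB 0 base.2⟩
    simp only [id] at hmaxi hmaxs
    have hi1 := hmaxi 1 (hA 1 base.1)
    have := uniq i0 0 s0 1 (Finset.mem_filter.1 hi0).2 (Finset.mem_filter.1 hs0).2 (by
      intro i j s m hf hg h1 h2
      have h3 := hGpos _ _ hg
      have hm : m = 1 := by omega
      have hj : j = 0 := by omega
      subst hm hj
      have h4 := hmaxi i (hA i hf)
      have h5 := hmaxs s (hB s hg)
      omega)
    have h2 : i0 + s0 = 1 := by
      rcases this with h | h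
      · rw [one_mul, zero_mul] at h; omega
      · exact h.1
    refine ⟨fun i hi => ?_, fun s hs => ?_⟩
    · have := hmaxi i (hA i hi); omega
    · have := hmaxs s (hB s hs); omega
  suffices hm2 : m < 2 by
    have h1 := hGpos s m hsm
    have hm : m = 1 := by omega
    subst hm
    exact ⟨part1.2 s hsm, rfl⟩
  by_contra hm2
  let box := Finset.range (D + 1) ×ˢ Finset.range (D + 1)
  let SF := box.filter (fun x => F x.1 x.2 ≠ 0)
  let SG := box.filter (fun x => G x.1 x.2 ≠ 0)
  have hSF : ∀ i j, (i, j) ∈ SF ↔ F i j ≠ 0 := by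
    intro i j
    simp only [SF, box, Finset.mem_filter, Finset.mem_product, Finset.mem_range]
    refine ⟨fun h => h.2, fun h => ⟨?_, h⟩⟩
    have := hF _ _ h
    omega
  have hSG : ∀ i j, (i, j) ∈ SG ↔ G i j ≠ 0 := by
    intro i j
    simp only [SG, box, Finset.mem_filter, Finset.mem_product, Finset.mem_range]
    refine ⟨fun h => h.2, fun h => ⟨?_, h⟩⟩
    have := hG _ _ h
    omega
  let T : Finset ℚ :=
    (SF.filter (fun x => 1 ≤ x.2)).image (fun x => ((x.1 : ℚ) - 1) / x.2) ∪
    (SG.filter (fun x => 2 ≤ x.2)).image (fun x => (x.1 : ℚ) / ((x.2 : ℚ) - 1))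
  have hTF : ∀ i j : ℕ, F i j ≠ 0 → 1 ≤ j → ((i : ℚ) - 1) / j ∈ T := fun i j h hj =>
    Finset.mem_union_left _ (Finset.mem_image.2
      ⟨(i, j), Finset.mem_filter.2 ⟨(hSF i j).2 h, hj⟩, rfl⟩)
  have hTG : ∀ i j : ℕ, G i j ≠ 0 → 2 ≤ j → (i : ℚ) / ((j : ℚ) - 1) ∈ T := fun i j h hj =>
    Finset.mem_union_right _ (Finset.mem_image.2
      ⟨(i, j), Finset.mem_filter.2 ⟨(hSG i j).2 h, hj⟩, rfl⟩)
  have hT0 := hTG s m hsm (by omega)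
  obtain ⟨τ, hτT, hτmax⟩ := Finset.exists_max_image T id ⟨_, hT0⟩
  simp only [id] at hτmax
  have hτ0 : 0 ≤ τ := by
    refine le_trans ?_ (hτmax _ hT0)
    have : (2 : ℚ) ≤ m := by exact_mod_cast (by omega : 2 ≤ m)
    exact div_nonneg (by positivity) (by linarith)
  have bF : ∀ i j : ℕ, F i j ≠ 0 → (i : ℚ) - τ * j ≤ 1 := by
    intro i j h
    rcases Nat.eq_zero_or_pos j with rfl | hj
    · have := part1.1 i h
      have h2 : (i : ℚ) ≤ 1 := by exact_mod_cast this
      simpa using h2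
    · have := hτmax _ (hTF i j h hj)
      have hj' : (0 : ℚ) < j := by exact_mod_cast hj
      rw [div_le_iff₀ hj'] at this
      linarith
  have bG : ∀ i j : ℕ, G i j ≠ 0 → (i : ℚ) - τ * ((j : ℚ) - 1) ≤ 0 := by
    intro i j h
    have h1 := hGpos i j h
    rcases Nat.lt_or_ge j 2 with hj | hj
    · have hj1 : j = 1 := by omega
      subst hj1
      rw [part1.2 i h]; simp
    · have := hτmax _ (hTG i j h hj)
      have hj' : (2 : ℚ) ≤ j := by exact_mod_cast hj
      rw [div_le_iff₀ (by linarith)] at this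
      linarith
  let EF := SF.filter (fun x => (x.1 : ℚ) - τ * x.2 = 1)
  let EG := SG.filter (fun x => (x.1 : ℚ) - τ * ((x.2 : ℚ) - 1) = 0)
  have hEF : ∀ i j, (i, j) ∈ EF ↔ F i j ≠ 0 ∧ (i : ℚ) - τ * j = 1 := by
    intro i j
    rw [Finset.mem_filter, hSF]
  have hEG : ∀ i j, (i, j) ∈ EG ↔ G i j ≠ 0 ∧ (i : ℚ) - τ * ((j : ℚ) - 1) = 0 := by
    intro i j
    rw [Finset.mem_filter, hSG]
  obtain ⟨⟨i0, j0⟩, h0F, hmF⟩ := Finset.exists_max_image EF (fun x => x.2)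
    ⟨(1, 0), (hEF 1 0).2 ⟨base.1, by simp⟩⟩
  obtain ⟨⟨s0, m0⟩, h0G, hmG⟩ := Finset.exists_max_image EG (fun x => x.2)
    ⟨(0, 1), (hEG 0 1).2 ⟨base.2, by simp⟩⟩
  simp only at hmF hmG
  rw [hEF] at h0F
  rw [hEG] at h0G
  have hm0 := hGpos _ _ h0G.1
  have hbig : 2 ≤ j0 + m0 := by
    rcases Finset.mem_union.1 hτT with h | h
    · obtain ⟨⟨i, j⟩, hij, he⟩ := Finset.mem_image.1 h
      obtain ⟨h1, h2⟩ := Finset.mem_filter.1 hij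
      simp only at he h2
      have hj' : (0 : ℚ) < j := by exact_mod_cast h2
      have := hmF (i, j) ((hEF i j).2 ⟨(hSF i j).1 h1, by
        rw [← he, div_mul_cancel₀ _ hj'.ne']; ring⟩)
      simp only at this
      omega
    · obtain ⟨⟨i, j⟩, hij, he⟩ := Finset.mem_image.1 h
      obtain ⟨h1, h2⟩ := Finset.mem_filter.1 hij
      simp only at he h2
      have hj' : (2 : ℚ) ≤ j := by exact_mod_cast h2
      have hj2 : (j : ℚ) - 1 ≠ 0 := by linarith
      have := hmG (i, j) ((hEG i j).2 ⟨(hSG i j).1 h1, by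
        rw [← he, div_mul_cancel₀ _ hj2]; ring⟩)
      simp only at this
      omega
  have hu := uniq i0 j0 s0 m0 h0F.1 h0G.1 (by
    intro i j s m hf hg h1 h2
    have e1 : (i : ℚ) + s = i0 + s0 := by exact_mod_cast h1
    have e2 : (j : ℚ) + m = j0 + m0 := by exact_mod_cast h2
    have e3 : τ * j + τ * m = τ * j0 + τ * m0 := by rw [← mul_add, e2, mul_add]
    have b1 := bF i j hf
    have b2 := bG s m hg
    have q1 := h0F.2
    have q2 := h0G.2
    have c1 : (i : ℚ) - τ * j = 1 := by linarith
    have c2 : (s : ℚ) - τ * ((m : ℚ) - 1) = 0 := by linarith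
    have d1 := hmF (i, j) ((hEF i j).2 ⟨hf, c1⟩)
    have d2 := hmG (s, m) ((hEG s m).2 ⟨hg, c2⟩)
    simp only at d1 d2
    have hj : j = j0 := by omega
    have hm : m = m0 := by omega
    subst hj hm
    have hi : (i : ℚ) = i0 := by linarith
    have hi' : i = i0 := by exact_mod_cast hi
    exact ⟨hi', rfl, by omega, rfl⟩)
  rcases hu with hu | hu
  · have e : (m0 : ℚ) * i0 = j0 * s0 := by exact_mod_cast hu
    have e1 : (i0 : ℚ) = 1 + τ * j0 := by linarith [h0F.2]
    have e2 : (s0 : ℚ) = τ * (m0 - 1) := by linarith [h0G.2]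
    rw [e1, e2] at e
    have e3 : (m0 : ℚ) = - (τ * j0) := by linear_combination e
    have hp : (1 : ℚ) ≤ m0 := by exact_mod_cast hm0
    have hn : 0 ≤ τ * j0 := by positivity
    linarith
  · omega

end Comb

section MainThm
open Polynomial

theorem jacobsonInt : IsJacobsonRing ℤ := by
  rw [isJacobsonRing_iff_prime_eq]
  intro P hP
  by_cases h : P = ⊥
  · subst h
    rw [eq_bot_iff]
    intro x hx
    rw [Ideal.mem_jacobson_bot] at hx
    have := Int.isUnit_iff.1 (hx x)
    rw [Ideal.mem_bot]
    rcases this with h | h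
    · nlinarith
    · nlinarith
  · have := hP.isMaximal h
    exact Ideal.jacobson_eq_self_of_isMaximal

theorem char_pos_of_ft (k : Type) [Field k] [Algebra.FiniteType ℤ k] (l : ℕ) [CharP k l] :
    l.Prime := by
  rcases CharP.char_is_prime_or_zero k l with h | h
  · exact h
  · exfalso
    subst h
    have := CharP.charP_to_charZero k
    have := jacobsonInt
    have := finite_of_finite_type_of_isJacobsonRing ℤ k
    have := Algebra.IsIntegral.of_finite ℤ k
    refine Int.not_isField (isField_of_isIntegral_of_isField (R := ℤ) (S := k) ?_
      (Field.toIsField k))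
    exact (algebraMap ℤ k).injective_int

theorem char_pos_of_surj (S k : Type) [CommRing S] [Algebra.FiniteType ℤ S] [Field k]
    (φ : S →+* k) (hφ : Function.Surjective φ) (l : ℕ) [CharP k l] : l.Prime := by
  haveI : Algebra.FiniteType ℤ k := Algebra.FiniteType.of_surjective φ.toIntAlgHom hφ
  exact char_pos_of_ft k l

theorem good_field (S : Type) [CommRing S] [Nontrivial S] [Algebra.FiniteType ℤ S] :
    ∃ (k : Type) (_ : Field k) (_ : Algebra S k) (l : ℕ), CharP k l ∧ l.Prime := by
  obtain ⟨m, hm⟩ := Ideal.exists_maximal S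
  letI : Field (S ⧸ m) := Ideal.Quotient.field m
  haveI : CharP (S ⧸ m) (ringChar (S ⧸ m)) := ringChar.charP _
  exact ⟨S ⧸ m, inferInstance, inferInstance, ringChar (S ⧸ m), inferInstance,
    char_pos_of_surj S (S ⧸ m) (Ideal.Quotient.mk m) Ideal.Quotient.mk_surjective _⟩

section
variable {S S' : Type} [CommRing S] [CommRing S'] [Algebra S S']

theorem wmap_inj (hi : Function.Injective (algebraMap S S')) :
    Function.Injective (wmap S S') := by
  intro a b hab
  apply cf_ext
  intro i j
  apply hi
  rw [← cf_wmap, ← cf_wmap, hab]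

theorem wmap_lift (w : Weyl S') (h : ∀ i j, ∃ s : S, algebraMap S S' s = cf w i j) :
    ∃ w' : Weyl S, wmap S S' w' = w := by
  choose e he using h
  obtain ⟨D, hD⟩ := cf_bound w
  refine ⟨∑ i ∈ Finset.range D, ∑ j ∈ Finset.range D, e i j • (Wx S ^ i * Wy S ^ j), ?_⟩
  conv_rhs => rw [w_expand w D D hD]
  simp only [map_sum, wmap_smul, map_mul, map_pow, wmap_x, wmap_y, he]
end

/-- the arithmetic part over the finitely generated ring -/
theorem main_S (S : Type) [CommRing S] [IsDomain S] [CharZero S] [Algebra.FiniteType ℤ S]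
    (p q : Weyl S) (h : q * p = p * q + 1) (hs : wa q = (-1 : S) • q) (D : ℕ) (hp : bd p D D)
    (hq : bd q D D) (d n : ℕ) (h1 : ∀ i j, d < i → cf q i j = 0)
    (h2 : ∀ j, n < j → cf q d j = 0) (hu : IsUnit (cf q d n))
    (hM : IsUnit ((2 + D * D).factorial : S)) : d = 0 ∧ n = 1 := by
  obtain ⟨k, _, _, l, hchar, hl⟩ := good_field S
  have hlM : 2 + D * D < l := by
    by_contra hle
    have h3 := hM.map (algebraMap S k)
    rw [map_natCast] at h3
    apply h3.ne_zero
    rw [CharP.cast_eq_zero_iff k l, hl.dvd_factorial]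
    omega
  have hk : (l : k) = 0 := CharP.cast_eq_zero k l
  have hreg : ∀ s : S, (l : S) * s = 0 → s = 0 := fun s hs' =>
    (mul_eq_zero.1 hs').resolve_left (by exact_mod_cast hl.ne_zero)
  have hbd : ∀ w : Weyl S, bd w D D → ∀ i j, algebraMap S k (cf (w ^ l) (l * i) (l * j)) ≠ 0 →
      i ≤ D ∧ j ≤ D := by
    intro w hw i j hne
    by_contra hcon
    apply hne
    have h3 : D < i ∨ D < j := by omega
    rw [bd_pow hw l, map_zero]
    exact h3.imp (fun h => Nat.mul_lt_mul_of_pos_left h hl.pos)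
            (fun h => Nat.mul_lt_mul_of_pos_left h hl.pos)
  refine comb_lemma (k := k) D (fun i j => algebraMap S k (cf (p ^ l) (l * i) (l * j)))
    (fun i j => algebraMap S k (cf (q ^ l) (l * i) (l * j))) (hbd p hp) (hbd q hq) ?_ ?_ ?_ d n ?_
  · intro a b ha hb hab
    rw [CharP.natCast_eq_natCast k l] at hab
    exact hab.eq_of_lt_of_lt (by omega) (by omega)
  · intro a b
    exact jac_final hl hreg p q h D hp hq hk a b
  · intro i
    obtain ⟨r, hr⟩ := odd_dvd hl (by omega) p q h hs i
    change algebraMap S k (cf (q ^ l) (l * i) (l * 0)) = 0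
    rw [mul_zero, hr, map_mul, map_natCast, hk, zero_mul]
  · change algebraMap S k (cf (q ^ l) (l * d) (l * n)) ≠ 0
    rw [lead_pow q d n h1 h2, map_pow]
    exact pow_ne_zero _ (hu.map (algebraMap S k)).ne_zero

theorem main_K {K : Type} [Field K] [CharZero K] (p q : Weyl K) (h : q * p = p * q + 1)
    (hs : wa q = (-1 : K) • q) : ∃ c : K, c ≠ 0 ∧ q = c • Wy K := by
  classical
  obtain ⟨D1, hD1⟩ := cf_bound p
  obtain ⟨D2, hD2⟩ := cf_bound q
  set D := D1 + D2 with hD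
  have hp : bd p D D := fun i j hij => hD1 i j (by omega)
  have hq : bd q D D := fun i j hij => hD2 i j (by omega)
  have hq0 : sg q ≠ 0 := by
    intro h0
    have : q = 0 := sg_inj (by rw [h0, sg_zero])
    rw [this, zero_mul, mul_zero, zero_add] at h
    have h2 := congrArg sg h
    rw [sg_zero, sg_one] at h2
    exact zero_ne_one h2
  set d := (sg q).natDegree with hd
  set n := (sg q).leadingCoeff.natDegree with hn
  have hc0 : cf q d n ≠ 0 := by
    change (sg q).leadingCoeff.leadingCoeff ≠ 0
    rw [leadingCoeff_ne_zero, leadingCoeff_ne_zero]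
    exact hq0
  have h1 : ∀ i j, d < i → cf q i j = 0 := by
    intro i j hi
    rw [cf, coeff_eq_zero_of_natDegree_lt hi, coeff_zero]
  have h2 : ∀ j, n < j → cf q d j = 0 := fun j hj => coeff_eq_zero_of_natDegree_lt hj
  have hdn : d = 0 ∧ n = 1 := by
    let box := Finset.range (D + 1) ×ˢ Finset.range (D + 1)
    let s : Finset K := box.image (fun x => cf p x.1 x.2) ∪ box.image (fun x => cf q x.1 x.2) ∪
      {(cf q d n)⁻¹, (((2 + D * D).factorial : K))⁻¹}
    let S := Algebra.adjoin ℤ (s : Set K)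
    have hsub : ∀ x ∈ s, x ∈ S := fun x hx => Algebra.subset_adjoin hx
    have hbox : ∀ i j, ¬ (D < i ∨ D < j) → (i, j) ∈ box := by
      intro i j hij
      simp only [box, Finset.mem_product, Finset.mem_range]
      omega
    have hpS : ∀ i j, cf p i j ∈ S := by
      intro i j
      by_cases hij : D < i ∨ D < j
      · rw [hp i j hij]; exact zero_mem _
      · exact hsub _ (Finset.mem_union_left _ (Finset.mem_union_left _
          (Finset.mem_image.2 ⟨(i, j), hbox i j hij, rfl⟩)))
    have hqS : ∀ i j, cf q i j ∈ S := by
      intro i j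
      by_cases hij : D < i ∨ D < j
      · rw [hq i j hij]; exact zero_mem _
      · exact hsub _ (Finset.mem_union_left _ (Finset.mem_union_right _
          (Finset.mem_image.2 ⟨(i, j), hbox i j hij, rfl⟩)))
    have hci : (cf q d n)⁻¹ ∈ S := hsub _ (Finset.mem_union_right _ (by simp))
    have hMi : (((2 + D * D).factorial : K))⁻¹ ∈ S := hsub _ (Finset.mem_union_right _ (by simp))
    have hinj : Function.Injective (algebraMap S K) := Subtype.val_injective
    haveI : Algebra.FiniteType ℤ S :=
      (Subalgebra.fg_iff_finiteType S).1 (Subalgebra.fg_adjoin_finset s)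
    haveI : CharZero S := ⟨fun a b hab => by
      have := congrArg (algebraMap S K) hab
      rw [map_natCast, map_natCast] at this
      exact_mod_cast this⟩
    obtain ⟨p', hp'⟩ := wmap_lift (S := S) p (fun i j => ⟨⟨_, hpS i j⟩, rfl⟩)
    obtain ⟨q', hq'⟩ := wmap_lift (S := S) q (fun i j => ⟨⟨_, hqS i j⟩, rfl⟩)
    have hcf : ∀ i j, cf q i j = 0 → cf q' i j = 0 := by
      intro i j h0
      apply hinj
      rw [← cf_wmap, hq', h0, map_zero]
    have hcfp : ∀ i j, cf p i j = 0 → cf p' i j = 0 := by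
      intro i j h0
      apply hinj
      rw [← cf_wmap, hp', h0, map_zero]
    refine main_S S p' q' ?_ ?_ D (fun i j hij => hcfp _ _ (hp i j hij))
      (fun i j hij => hcf _ _ (hq i j hij)) d n (fun i j hij => hcf _ _ (h1 i j hij))
      (fun j hj => hcf _ _ (h2 j hj)) ?_ ?_
    · apply wmap_inj hinj
      rw [map_add, map_mul, map_mul, map_one, hp', hq', h]
    · apply wmap_inj hinj
      rw [wmap_smul, ← wa_wmap, hq', hs, map_neg, map_one]
    · refine IsUnit.of_mul_eq_one ⟨_, hci⟩ ?_
      apply hinj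
      rw [map_mul, ← cf_wmap, hq', map_one]
      exact mul_inv_cancel₀ hc0
    · refine IsUnit.of_mul_eq_one ⟨_, hMi⟩ ?_
      apply hinj
      rw [map_mul, map_natCast, map_one]
      exact mul_inv_cancel₀ (by exact_mod_cast Nat.factorial_ne_zero _)
  rw [hdn.1] at h1 h2
  rw [hdn.2] at h2
  have e := w_expand q 1 2 (by
    intro i j hij
    rcases Nat.eq_zero_or_pos i with rfl | hi
    · exact h2 j (by omega)
    · exact h1 i j hi)
  simp only [Finset.sum_range_succ, Finset.sum_range_zero, zero_add, pow_zero, one_mul,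
    pow_one] at e
  rw [hdn.1, hdn.2] at hc0
  have e0 : cf q 0 0 = 0 := by
    have h3 := congrArg (fun w => cf w 0 0) hs
    have h4 : wa q = cf q 0 0 • (Wx K ^ 0 * Wy K ^ 0) +
        (cf q 0 1 * -1) • (Wx K ^ 0 * Wy K ^ 1) := by
      conv_lhs => rw [e]
      have w1 : wa (1 : Weyl K) = 1 := by
        have := wa_alg (1 : K)
        rwa [map_one] at this
      rw [wa_add, wa_smul, wa_smul, wa_y, w1, smul_smul, pow_zero, pow_zero, pow_one, one_mul,
        one_mul]
    simp only [h4, cf_add, cf_smul, cf_mono] at h3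
    have h5 : cf q 0 0 = - cf q 0 0 := by simpa using h3
    linear_combination h5 / 2
  rw [e0, zero_smul, zero_add] at e
  exact ⟨cf q 0 1, hc0, e⟩

end MainThm

section FinalPart
open Polynomial

variable {K : Type} [Field K]

theorem gen_theta [CharZero K] {B : Type*} [Ring B] [Algebra K B] {a b : B}
    (h : b * a = a * b + 1) :
    ((1/2 : K) • b + (-1/2 : K) • a) * (a + b) = (a + b) * ((1/2 : K) • b + (-1/2 : K) • a) + 1 := by
  simp only [add_mul, mul_add, smul_mul_assoc, mul_smul_comm, h, smul_add]
  have : (1 : B) = (1 : K) • 1 := (one_smul _ _).symm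
  rw [this]
  module

theorem gen_eta [CharZero K] {B : Type*} [Ring B] [Algebra K B] {a b : B}
    (h : b * a = a * b + 1) :
    ((1/2 : K) • a + b) * ((1/2 : K) • a + (-1 : K) • b) =
      ((1/2 : K) • a + (-1 : K) • b) * ((1/2 : K) • a + b) + 1 := by
  simp only [add_mul, mul_add, smul_mul_assoc, mul_smul_comm, h, smul_add]
  have : (1 : B) = (1 : K) • 1 := (one_smul _ _).symm
  rw [this]
  module

theorem gen_tri {B : Type*} [Ring B] [Algebra K B] {a b u : B} {c : K} (hc : c ≠ 0)
    (h : b * a = a * b + 1) (hu : b * u = u * b) :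
    (c⁻¹ • b) * (c • a + (-c) • u) = (c • a + (-c) • u) * (c⁻¹ • b) + 1 := by
  simp only [add_mul, mul_add, smul_mul_assoc, mul_smul_comm, h, hu, smul_add, smul_smul]
  rw [inv_mul_cancel₀ hc, one_smul]
  rw [mul_inv_cancel₀ hc, one_smul, neg_mul, mul_neg, inv_mul_cancel₀ hc, mul_inv_cancel₀ hc]
  rw [one_smul, add_assoc, add_assoc, add_comm 1]

theorem gen_id1 [CharZero K] {B : Type*} [AddCommMonoid B] [Module K B] (a b : B) :
    (1/2 : K) • (a + b) + (-1 : K) • ((1/2 : K) • b + (-1/2 : K) • a) = a := by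
  module
theorem gen_id2 [CharZero K] {B : Type*} [AddCommMonoid B] [Module K B] (a b : B) :
    (1/2 : K) • (a + b) + ((1/2 : K) • b + (-1/2 : K) • a) = b := by
  module
theorem gen_id3 [CharZero K] {B : Type*} [AddCommMonoid B] [Module K B] (a b : B) :
    ((1/2 : K) • a + (-1 : K) • b) + ((1/2 : K) • a + b) = a := by
  module
theorem gen_id4 [CharZero K] {B : Type*} [AddCommMonoid B] [Module K B] (a b : B) :
    (1/2 : K) • ((1/2 : K) • a + b) + (-1/2 : K) • ((1/2 : K) • a + (-1 : K) • b) = b := by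
  module
theorem gen_id5 {B : Type*} [AddCommMonoid B] [Module K B] (a b : B) :
    (1/2 : K) • a + (-1/2 : K) • b = (-1 : K) • ((1/2 : K) • b + (-1/2 : K) • a) := by
  module
theorem gen_id6 {B : Type*} [AddCommMonoid B] [Module K B] (a u : B) {c : K} (hc : c ≠ 0) :
    c⁻¹ • (c • a + (-c) • u) + u = a := by
  rw [smul_add, smul_smul, smul_smul, inv_mul_cancel₀ hc, mul_neg, inv_mul_cancel₀ hc]
  module
theorem gen_id7 {B : Type*} [AddCommMonoid B] [Module K B] (a u : B) {c : K} (hc : c ≠ 0) :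
    c • (c⁻¹ • a + u) + (-c) • u = a := by
  rw [smul_add, smul_smul, mul_inv_cancel₀ hc]
  module
theorem gen_id8 {B : Type*} [AddCommMonoid B] [Module K B] (a b : B) :
    (1/2 : K) • a + (-1 : K) • ((-1 : K) • b) = (1/2 : K) • a + b := by
  module

variable [CharZero K]

theorem p_form (p : Weyl K) (c : K) (hc : c ≠ 0)
    (h : (c • Wy K) * p = p * (c • Wy K) + 1) :
    ∃ hh : K[X], p = c⁻¹ • Wx K + aeval (Wy K) hh := by
  have h1 : c • (Wy K * p - p * Wy K) = Wx K ^ 0 * Wy K ^ 0 := by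
    have e : c • (Wy K * p - p * Wy K) + c • (p * Wy K) = c • (p * Wy K) + 1 := by
      rw [← smul_add, sub_add_cancel, ← smul_mul_assoc, h, mul_smul_comm]
    rw [add_comm (c • (p * Wy K)) 1] at e
    rw [pow_zero, pow_zero, one_mul]
    exact add_right_cancel e
  have h2 : ∀ i j, c * (((i + 1 : ℕ) : K) * cf p (i + 1) j) = if 0 = i ∧ 0 = j then 1 else 0 := by
    intro i j
    rw [← cf_comm_y, ← cf_smul, h1, cf_mono]
  refine ⟨(sg p).coeff 0, ?_⟩
  have h3 : sg p = monomial 1 (C c⁻¹) + monomial 0 ((sg p).coeff 0) := by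
    ext i j
    rw [coeff_add, coeff_monomial, coeff_monomial]
    rcases i with _ | i
    · simp
    · have h4 := h2 i j
      change cf p (i + 1) j = _
      have hi : ((i + 1 : ℕ) : K) ≠ 0 := by exact_mod_cast Nat.succ_ne_zero i
      by_cases hij : 0 = i ∧ 0 = j
      · obtain ⟨rfl, rfl⟩ := hij
        simp only [and_self, if_true, zero_add, Nat.cast_one, one_mul] at h4
        simp only [zero_add, if_true, one_ne_zero, zero_ne_one, if_false, add_zero, coeff_C_zero]
        field_simp
        linear_combination h4
      · rw [if_neg hij, mul_eq_zero, mul_eq_zero] at h4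
        rw [(h4.resolve_left hc).resolve_left hi]
        by_cases h0 : 0 = i
        · subst h0
          have : j ≠ 0 := fun h => hij ⟨rfl, h.symm⟩
          simp [coeff_C, this]
        · have : ¬ (i = 0) := fun h => h0 h.symm
          simp [this]
  calc p = NN (sg p) := (NN_sg p).symm
    _ = NN (monomial 1 (C c⁻¹) + monomial 0 ((sg p).coeff 0)) := by rw [← h3]
    _ = _ := by
      rw [map_add, NN_monomial, NN_monomial, pow_one, pow_zero, one_mul, aeval_C,
        ← Algebra.commutes, ← Algebra.smul_def]

theorem psi_bij (ψ : Weyl K →ₐ[K] Weyl K) (hs : wa (ψ (Wy K)) = (-1 : K) • ψ (Wy K)) :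
    Function.Bijective ψ := by
  have hr : ψ (Wy K) * ψ (Wx K) = ψ (Wx K) * ψ (Wy K) + 1 := by
    rw [← map_mul, wrel, map_add, map_mul, map_one]
  obtain ⟨c, hc, hq⟩ := main_K _ _ hr hs
  rw [hq] at hr
  obtain ⟨hh, hp⟩ := p_form _ c hc hr
  have hcomm : Wy K * aeval (c⁻¹ • Wy K) hh = aeval (c⁻¹ • Wy K) hh * Wy K := by
    have h1 : Commute (Wy K) (c⁻¹ • Wy K) := (Commute.refl (Wy K)).smul_right c⁻¹
    refine Polynomial.induction_on' (motive := fun g => Wy K * aeval (c⁻¹ • Wy K) g =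
      aeval (c⁻¹ • Wy K) g * Wy K) hh ?_ ?_
    · intro a b ha hb
      rw [map_add, mul_add, add_mul, ha, hb]
    · intro n r
      rw [aeval_monomial, ← mul_assoc, ← Algebra.commutes, mul_assoc, mul_assoc,
        (h1.pow_right n).eq]
  let φ : Weyl K →ₐ[K] Weyl K := wlift _ _ (gen_tri hc (wrel (S := K)) hcomm)
  have fx : φ (Wx K) = c • Wx K + (-c) • aeval (c⁻¹ • Wy K) hh := wlift_x _ _ _
  have fy : φ (Wy K) = c⁻¹ • Wy K := wlift_y _ _ _
  have l1 : φ.comp ψ = AlgHom.id K _ := by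
    apply whom_ext
    · rw [AlgHom.comp_apply, hp, map_add, map_smul, ← Polynomial.aeval_algHom_apply, fx, fy,
        AlgHom.id_apply]
      exact gen_id6 _ _ hc
    · rw [AlgHom.comp_apply, hq, map_smul, fy, smul_smul, mul_inv_cancel₀ hc, one_smul,
        AlgHom.id_apply]
  have l2 : ψ.comp φ = AlgHom.id K _ := by
    apply whom_ext
    · rw [AlgHom.comp_apply, fx, map_add, map_smul, map_smul, ← Polynomial.aeval_algHom_apply,
        map_smul, hq, smul_smul, inv_mul_cancel₀ hc, one_smul, hp,
        AlgHom.id_apply]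
      exact gen_id7 _ _ hc
    · rw [AlgHom.comp_apply, fy, map_smul, hq, smul_smul, inv_mul_cancel₀ hc, one_smul,
        AlgHom.id_apply]
  refine Function.bijective_iff_has_inverse.2 ⟨φ, fun w => ?_, fun w => ?_⟩
  · exact congrArg (fun f : Weyl K →ₐ[K] Weyl K => f w) l1
  · exact congrArg (fun f : Weyl K →ₐ[K] Weyl K => f w) l2

theorem h_bij (α : Weyl K → Weyl K) (hα : IsExchange K α) (h : Weyl K →ₐ[K] Weyl K)
    (h1 : α (h (Wx K)) = h (Wy K)) (h2 : α (h (Wy K)) = h (Wx K)) : Function.Bijective h := by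
  obtain ⟨⟨⟨⟨aadd, asmul, amul, aone⟩, -⟩, -⟩, ax, ay⟩ := hα
  let θ : Weyl K →ₐ[K] Weyl K := wlift _ _ (gen_theta (K := K) (wrel (S := K)))
  let η : Weyl K →ₐ[K] Weyl K := wlift _ _ (gen_eta (K := K) (wrel (S := K)))
  have tx : θ (Wx K) = Wx K + Wy K := wlift_x _ _ _
  have ty : θ (Wy K) = (1/2 : K) • Wy K + (-1/2 : K) • Wx K := wlift_y _ _ _
  have ex : η (Wx K) = (1/2 : K) • Wx K + (-1 : K) • Wy K := wlift_x _ _ _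
  have ey : η (Wy K) = (1/2 : K) • Wx K + Wy K := wlift_y _ _ _
  have te : θ.comp η = AlgHom.id K _ := by
    apply whom_ext
    · rw [AlgHom.comp_apply, ex, map_add, map_smul, map_smul, tx, ty, AlgHom.id_apply]
      exact gen_id1 _ _
    · rw [AlgHom.comp_apply, ey, map_add, map_smul, tx, ty, AlgHom.id_apply]
      exact gen_id2 _ _
  have et : η.comp θ = AlgHom.id K _ := by
    apply whom_ext
    · rw [AlgHom.comp_apply, tx, map_add, ex, ey, AlgHom.id_apply]
      exact gen_id3 _ _
    · rw [AlgHom.comp_apply, ty, map_add, map_smul, map_smul, ex, ey, AlgHom.id_apply]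
      exact gen_id4 _ _
  have te' : ∀ w, θ (η w) = w := fun w => congrArg (fun f : Weyl K →ₐ[K] Weyl K => f w) te
  have et' : ∀ w, η (θ w) = w := fun w => congrArg (fun f : Weyl K →ₐ[K] Weyl K => f w) et
  let A : Subalgebra K (Weyl K) :=
    { carrier := {w | wa (η w) = η (α w)}
      mul_mem' := by
        intro a b ha hb
        change wa (η (a * b)) = η (α (a * b))
        rw [map_mul, wa_mul, amul, map_mul]
        exact congrArg₂ (· * ·) hb ha
      add_mem' := by
        intro a b ha hb
        change wa (η (a + b)) = η (α (a + b))
        rw [map_add, wa_add, aadd, map_add]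
        exact congrArg₂ (· + ·) ha hb
      algebraMap_mem' := by
        intro r
        change wa (η _) = η (α _)
        rw [AlgHom.commutes, wa_alg, Algebra.algebraMap_eq_smul_one, asmul, aone, map_smul,
          map_one] }
  have hw : ∀ w, wa (η w) = η (α w) := wsub_top A
    (by
      change wa (η _) = η (α _)
      rw [ax, ex, ey, wa_add, wa_smul, wa_smul, wa_x, wa_y]
      exact gen_id8 _ _)
    (by
      change wa (η _) = η (α _)
      rw [ay, ex, ey, wa_add, wa_smul, wa_x, wa_y])
  let ψ : Weyl K →ₐ[K] Weyl K := η.comp (h.comp θ)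
  have hψ : Function.Bijective ψ := by
    apply psi_bij
    change wa (η (h (θ (Wy K)))) = (-1 : K) • (η (h (θ (Wy K))))
    rw [hw, ← map_smul, ty, map_add, map_smul, map_smul, aadd, asmul, asmul, h1, h2]
    exact congrArg η (gen_id5 _ _)
  have bθ : Function.Bijective θ := Function.bijective_iff_has_inverse.2 ⟨η, et', te'⟩
  have bη : Function.Bijective η := Function.bijective_iff_has_inverse.2 ⟨θ, te', et'⟩
  have e : (h : Weyl K → Weyl K) = θ ∘ ψ ∘ η := by
    funext w
    change h w = θ (η (h (θ (η w))))
    rw [te', te']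
  rw [e]
  exact bθ.comp (hψ.comp bη)

def mkHom (f : Weyl K → Weyl K) (hf : IsAlgEndo K f) : Weyl K →ₐ[K] Weyl K :=
  AlgHom.ofLinearMap
    { toFun := f
      map_add' := hf.1
      map_smul' := hf.2.1 } hf.2.2.2 hf.2.2.1

theorem final_aux (α f g Γ : Weyl K → Weyl K) (hα : IsExchange K α) (hf : IsAlgEndo K f)
    (hg : IsAlgAuto K g) (hG : ∀ w, g (Γ w) = α (g w))
    (hP : Γ (f (Wx K)) = f (Wy K)) (hQ : Γ (f (Wy K)) = f (Wx K)) :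
    IsAlgAuto K f := by
  refine ⟨hf, ?_⟩
  have hgf : IsAlgEndo K (g ∘ f) := by
    obtain ⟨⟨g1, g2, g3, g4⟩, -⟩ := hg
    obtain ⟨f1, f2, f3, f4⟩ := hf
    refine ⟨fun a b => ?_, fun c a => ?_, fun a b => ?_, ?_⟩
    · simp only [Function.comp_apply, f1, g1]
    · simp only [Function.comp_apply, f2, g2]
    · simp only [Function.comp_apply, f3, g3]
    · simp only [Function.comp_apply, f4, g4]
  have hb : Function.Bijective (mkHom (g ∘ f) hgf) := by
    apply h_bij α hα
    · change α (g (f _)) = g (f _)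
      rw [← hG, hP]
    · change α (g (f _)) = g (f _)
      rw [← hG, hQ]
  exact (Function.Bijective.of_comp_iff' hg.2 f).1 hb

end FinalPart

/-- extension condition, first version: if some involution `Γ` on `A₁`,
conjugate to `α`, exchanges `P = f X` and `Q = f Y`, then `f` is an automorphism. -/
theorem stmt_6 {K : Type} [Field K] [CharZero K]
    (α f : Weyl K → Weyl K) (hα : IsExchange K α) (hf : IsAlgEndo K f)
    (Γ : Weyl K → Weyl K) (hΓ : IsInvolutionOn K Γ) (hΓα : ConjToAlpha K α Γ)
    (hP : Γ (f (Wx K)) = f (Wy K)) (hQ : Γ (f (Wy K)) = f (Wx K)) :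
    IsAlgAuto K f := by
  obtain ⟨g, hg, hΓg⟩ := hΓα
  have hgb : Function.Bijective g := hg.elim (fun h => h.2) (fun h => h.2)
  have hG : ∀ w, g (Γ w) = α (g w) := by
    intro w
    rw [hΓg]
    exact Function.rightInverse_invFun hgb.2 (α (g w))
  rcases hg with hg | hg
  · exact final_aux α f g Γ hα hf hg hG hP hQ
  · refine final_aux α f (α ∘ g) Γ hα hf ?_ (fun w => ?_) hP hQ
    · obtain ⟨⟨⟨a1, a2, a3, a4⟩, ab⟩, -⟩ := hα.1
      obtain ⟨⟨g1, g2, g3, g4⟩, -⟩ := hg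
      refine ⟨⟨fun a b => ?_, fun c a => ?_, fun a b => ?_, ?_⟩, ab.comp hgb⟩
      · simp only [Function.comp_apply, g1, a1]
      · simp only [Function.comp_apply, g2, a2]
      · simp only [Function.comp_apply, g3, a3]
      · simp only [Function.comp_apply, g4, a4]
    · simp only [Function.comp_apply, hG]
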